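/- arXiv:1708.08607 — 2 statements merged into one kernel-verified Lean document; each statement's English description precedes it below -/
import Mathlib

section
/- The average entanglement entropy of all eigenstates satisfies S̄ := (1/d) Σ_{j=1}^d S(ρ_{j,A}) ≤ m·ln 2 − f·⟨H_1²⟩/4, where ⟨X⟩ := d^{-1} tr X denotes the infinite-temperature expectation value. -/
open Finset Matrix
open scoped ComplexOrder

noncomputable section

/-- The Hilbert space of a chain of `n` spin-1/2's, `(ℂ²)^{⊗n}`, in the computational basis:
a state assigns an amplitude to each configuration `Fin n → Fin 2`. -/
abbrev QState (n : ℕ) : Type := (Fin n → Fin 2) → ℂ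

/-- Operators on the chain of `n` spin-1/2's. -/
abbrev QOp (n : ℕ) : Type := Matrix (Fin n → Fin 2) (Fin n → Fin 2) ℂ

/-- von Neumann entropy `S(ρ) = -tr(ρ ln ρ)` (natural logarithm), via eigenvalues. -/
noncomputable def vnEntropy {ι : Type} [Fintype ι] [DecidableEq ι] (ρ : Matrix ι ι ℂ) : ℝ := by
  classical
  exact if h : ρ.IsHermitian then -∑ i, h.eigenvalues i * Real.log (h.eigenvalues i) else 0

/-- Operator norm (`ℓ² → ℓ²`) of a matrix. -/
noncomputable def opNorm {ι : Type} [Fintype ι] [DecidableEq ι] (M : Matrix ι ι ℂ) : ℝ :=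
  ‖LinearMap.toContinuousLinearMap (Matrix.toEuclideanLin M)‖

/-- Combine a configuration of the first `m` sites with one of the remaining `n - m` sites. -/
def joinCfg (n m : ℕ) (a : Fin m → Fin 2) (b : Fin (n - m) → Fin 2) : Fin n → Fin 2 :=
  fun i => if hi : (i : ℕ) < m then a ⟨i, hi⟩ else b ⟨(i : ℕ) - m, by have := i.isLt; omega⟩

/-- Reduced density matrix `ρ_A = tr_B |ψ⟩⟨ψ|` of a pure state, where `A` consists of the
first `m` spins and `B` of the remaining `n - m` spins. -/
noncomputable def rdm (n m : ℕ) (ψ : QState n) :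
    Matrix (Fin m → Fin 2) (Fin m → Fin 2) ℂ :=
  fun a a' => ∑ b : Fin (n - m) → Fin 2,
    ψ (joinCfg n m a b) * (starRingEnd ℂ) (ψ (joinCfg n m a' b))

/-- Entanglement entropy of a pure state between the first `m` spins and the rest. -/
noncomputable def entEntropy (n m : ℕ) (ψ : QState n) : ℝ := vnEntropy (rdm n m ψ)

/-- The cyclic successor `i + 1 (mod n)` of a site of the periodic chain. -/
def finSucc {n : ℕ} (i : Fin n) : Fin n := ⟨((i : ℕ) + 1) % n, Nat.mod_lt _ i.pos⟩

/-- Translation (cyclic shift by one site) acting on configurations. -/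
def shiftCfg {n : ℕ} (σ : Fin n → Fin 2) : Fin n → Fin 2 := fun i => σ (finSucc i)

/-- `M` acts only on the sites in `S`, i.e. `M = K ⊗ 1` with `K` supported on `S`:
matrix elements vanish unless the configurations agree off `S`, and they depend only on
the restriction of the configurations to `S`. -/
def ActsOn {n : ℕ} (S : Finset (Fin n)) (M : QOp n) : Prop :=
  (∀ σ τ : Fin n → Fin 2, (∃ i ∉ S, σ i ≠ τ i) → M σ τ = 0) ∧
  (∀ σ τ σ' τ' : Fin n → Fin 2, (∀ i ∈ S, σ i = σ' i) → (∀ i ∈ S, τ i = τ' i) →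
    (∀ i ∉ S, σ i = τ i) → (∀ i ∉ S, σ' i = τ' i) → M σ τ = M σ' τ')


theorem aux_entropy_le {ι : Type} [Fintype ι] [DecidableEq ι] (ρ : Matrix ι ι ℂ)
    (hρ : ρ.PosSemidef) (htr : ρ.trace = 1) (U : Matrix ι ι ℂ) (hU1 : Uᴴ * U = 1)
    (r : ι → ℝ) (hr : ∀ s, 0 < r s) (hr1 : ∑ s, r s ≤ 1) :
    vnEntropy ρ ≤ -∑ s, ((Uᴴ * ρ * U) s s).re * Real.log (r s) := by
  have hU2 : U * Uᴴ = 1 := mul_eq_one_comm.mp hU1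
  have hH := hρ.isHermitian
  set p := hH.eigenvalues with hp
  have hp0 : ∀ i, 0 ≤ p i := fun i => hρ.eigenvalues_nonneg i
  have hp1 : ∑ i, p i = 1 := by
    have := hH.trace_eq_sum_eigenvalues
    rw [htr] at this
    have h2 : ((∑ i, p i : ℝ) : ℂ) = 1 := by
      push_cast
      exact this.symm
    exact_mod_cast h2
  have hS : vnEntropy ρ = -∑ i, p i * Real.log (p i) := by
    unfold vnEntropy
    rw [dif_pos hH, hp]
  set Φ : Matrix ι ι ℂ := (hH.eigenvectorUnitary : Matrix ι ι ℂ) with hΦ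
  have hΦ1 : Φᴴ * Φ = 1 := by
    have := Unitary.coe_star_mul_self hH.eigenvectorUnitary
    simpa [Matrix.star_eq_conjTranspose] using this
  have hΦ2 : Φ * Φᴴ = 1 := mul_eq_one_comm.mp hΦ1
  have hspec : ρ = Φ * Matrix.diagonal (fun i => (p i : ℂ)) * Φᴴ := by
    have := hH.spectral_theorem
    rw [Unitary.conjStarAlgAut_apply] at this
    exact this
  set W : Matrix ι ι ℂ := Uᴴ * Φ with hW
  have hWW : W * Wᴴ = 1 := by
    rw [hW, conjTranspose_mul, conjTranspose_conjTranspose]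
    calc Uᴴ * Φ * (Φᴴ * U) = Uᴴ * (Φ * Φᴴ) * U := by simp only [Matrix.mul_assoc]
      _ = 1 := by rw [hΦ2, Matrix.mul_one, hU1]
  have hWW' : Wᴴ * W = 1 := mul_eq_one_comm.mp hWW
  have hq : Uᴴ * ρ * U = W * Matrix.diagonal (fun i => (p i : ℂ)) * Wᴴ := by
    rw [hspec, hW, conjTranspose_mul, conjTranspose_conjTranspose]
    simp only [Matrix.mul_assoc]
  have hqs : ∀ s, ((Uᴴ * ρ * U) s s).re = ∑ i, Complex.normSq (W s i) * p i := by
    intro s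
    rw [hq, Matrix.mul_apply, Complex.re_sum]
    refine Finset.sum_congr rfl fun i _ => ?_
    rw [Matrix.mul_diagonal, conjTranspose_apply]
    have : W s i * (p i : ℂ) * star (W s i) = ((Complex.normSq (W s i) * p i : ℝ) : ℂ) := by
      push_cast
      rw [Complex.normSq_eq_conj_mul_self]
      simp only [Complex.star_def]
      ring
    rw [this, Complex.ofReal_re]
  have hrow : ∀ s, ∑ i, Complex.normSq (W s i) = 1 := by
    intro s
    have := congrFun (congrFun hWW s) s
    rw [Matrix.mul_apply, Matrix.one_apply_eq] at this
    have h2 : ((∑ i, Complex.normSq (W s i) : ℝ) : ℂ) = 1 := by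
      rw [← this]; push_cast
      refine Finset.sum_congr rfl fun i _ => ?_
      rw [Complex.normSq_eq_conj_mul_self, conjTranspose_apply, Complex.star_def, mul_comm]
    exact_mod_cast h2
  have hcol : ∀ i, ∑ s, Complex.normSq (W s i) = 1 := by
    intro s
    have := congrFun (congrFun hWW' s) s
    rw [Matrix.mul_apply, Matrix.one_apply_eq] at this
    have h2 : ((∑ i, Complex.normSq (W i s) : ℝ) : ℂ) = 1 := by
      rw [← this]; push_cast
      refine Finset.sum_congr rfl fun i _ => ?_
      rw [Complex.normSq_eq_conj_mul_self, conjTranspose_apply, Complex.star_def]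
    exact_mod_cast h2
  have key : ∀ s i, p i * (Real.log (r s) - Real.log (p i)) ≤ r s - p i := by
    intro s i
    rcases (hp0 i).eq_or_lt with h | h
    · rw [← h]; simp [(hr s).le]
    · rw [← Real.log_div (hr s).ne' h.ne']
      have := Real.log_le_sub_one_of_pos (div_pos (hr s) h)
      calc p i * Real.log (r s / p i) ≤ p i * (r s / p i - 1) := by gcongr
        _ = r s - p i := by field_simp
  rw [hS]
  have e1 : ∑ s, ((Uᴴ * ρ * U) s s).re * Real.log (r s)
      = ∑ s, ∑ i, Complex.normSq (W s i) * (p i * Real.log (r s)) := by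
    refine Finset.sum_congr rfl fun s _ => ?_
    rw [hqs, Finset.sum_mul]
    exact Finset.sum_congr rfl fun i _ => by ring
  have e2 : ∑ i, p i * Real.log (p i)
      = ∑ s, ∑ i, Complex.normSq (W s i) * (p i * Real.log (p i)) := by
    rw [Finset.sum_comm]
    refine Finset.sum_congr rfl fun s _ => ?_
    rw [← Finset.sum_mul, hcol, one_mul]
  have e3 : ∑ s, ∑ i, Complex.normSq (W s i) * r s = ∑ s, r s := by
    refine Finset.sum_congr rfl fun s _ => ?_
    rw [← Finset.sum_mul, hrow, one_mul]
  have e4 : ∑ s, ∑ i, Complex.normSq (W s i) * p i = 1 := by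
    rw [Finset.sum_comm, ← hp1]
    refine Finset.sum_congr rfl fun s _ => ?_
    rw [← Finset.sum_mul, hcol, one_mul]
  have e5 : ∑ s, ∑ i, Complex.normSq (W s i) * (p i * (Real.log (r s) - Real.log (p i)))
      ≤ ∑ s, ∑ i, Complex.normSq (W s i) * (r s - p i) := by
    refine Finset.sum_le_sum fun s _ => Finset.sum_le_sum fun i _ => ?_
    exact mul_le_mul_of_nonneg_left (key s i) (Complex.normSq_nonneg _)
  simp only [mul_sub, Finset.sum_sub_distrib] at e5
  rw [e3, e4, ← e1, ← e2] at e5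
  linarith

theorem aux_hoeff {κ : Type} [Fintype κ] (hc : Fintype.card κ = 4) (ε : κ → ℝ)
    (h0 : ∑ c, ε c = 0) (h1 : ∀ c, |ε c| ≤ 1) (l : ℝ) :
    ∑ c, Real.exp (l * ε c - l ^ 2 / 2 - Real.log 4) ≤ 1 := by
  have h : ∀ c, Real.exp (l * ε c) ≤ Real.cosh l + ε c * Real.sinh l := by
    intro c
    rw [mul_comm]
    exact Real.exp_mul_le_cosh_add_mul_sinh (h1 c) l
  have hs : ∑ c, Real.exp (l * ε c) ≤ 4 * Real.exp (l ^ 2 / 2) := by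
    calc _ ≤ ∑ c, (Real.cosh l + ε c * Real.sinh l) := Finset.sum_le_sum fun c _ => h c
      _ = 4 * Real.cosh l := by
        rw [Finset.sum_add_distrib, ← Finset.sum_mul, h0]; simp [hc]
      _ ≤ _ := by gcongr; exact Real.cosh_le_exp_half_sq l
  have : ∀ c, Real.exp (l * ε c - l ^ 2 / 2 - Real.log 4)
      = Real.exp (l * ε c) * (4 * Real.exp (l ^ 2 / 2))⁻¹ := by
    intro c
    rw [Real.exp_sub, Real.exp_sub, Real.exp_log (by norm_num)]
    field_simp
  simp only [this, ← Finset.sum_mul]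
  rw [← div_eq_mul_inv, div_le_one (by positivity)]
  exact hs

theorem aux_acts_mono {n : ℕ} {S T : Finset (Fin n)} (hST : S ⊆ T) {M : QOp n}
    (h : ActsOn S M) : ActsOn T M := by
  refine ⟨fun σ τ ⟨i, hi, hne⟩ => h.1 σ τ ⟨i, fun hh => hi (hST hh), hne⟩, ?_⟩
  intro σ τ σ' τ' h1 h2 h3 h4
  by_cases hc : ∃ i ∉ S, σ i ≠ τ i
  · obtain ⟨i, hi, hne⟩ := hc
    have hiT : i ∈ T := by
      by_contra hh; exact hne (h3 i hh)
    rw [h.1 σ τ ⟨i, hi, hne⟩, h.1 σ' τ' ⟨i, hi, by rw [← h1 i hiT, ← h2 i hiT]; exact hne⟩]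
  · push Not at hc
    refine h.2 σ τ σ' τ' (fun i hi => h1 i (hST hi)) (fun i hi => h2 i (hST hi)) hc ?_
    intro i hi
    by_cases hiT : i ∈ T
    · rw [← h1 i hiT, ← h2 i hiT]; exact hc i hi
    · exact h4 i hiT

theorem aux_acts_add {n : ℕ} {S : Finset (Fin n)} {M N : QOp n}
    (hM : ActsOn S M) (hN : ActsOn S N) : ActsOn S (M + N) := by
  refine ⟨fun σ τ h => by simp [hM.1 σ τ h, hN.1 σ τ h], ?_⟩
  intro σ τ σ' τ' h1 h2 h3 h4
  simp [hM.2 σ τ σ' τ' h1 h2 h3 h4, hN.2 σ τ σ' τ' h1 h2 h3 h4]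

theorem aux_opNorm {ι : Type} [Fintype ι] [DecidableEq ι] (M : Matrix ι ι ℂ) (ε : ℝ)
    (ψ : ι → ℂ) (hψ : ψ ≠ 0) (h : M *ᵥ ψ = (ε : ℂ) • ψ) : |ε| ≤ opNorm M := by
  have h1 := (LinearMap.toContinuousLinearMap (Matrix.toEuclideanLin M)).le_opNorm
    (WithLp.toLp 2 ψ)
  have h2 : (LinearMap.toContinuousLinearMap (Matrix.toEuclideanLin M)) (WithLp.toLp 2 ψ)
      = (ε : ℂ) • WithLp.toLp 2 ψ := by
    rw [LinearMap.coe_toContinuousLinearMap', Matrix.toLpLin_toLp, Matrix.toLin'_apply, h]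
    rfl
  rw [h2, norm_smul] at h1
  have h3 : 0 < ‖WithLp.toLp 2 ψ‖ := by
    rw [norm_pos_iff]
    intro h0
    exact hψ (congrArg WithLp.ofLp h0)
  have := le_of_mul_le_mul_right h1 h3
  simpa [opNorm] using this

/-- Group the spins of a configuration into consecutive pairs. -/
def auxPr (M : ℕ) : (Fin (M * 2) → Fin 2) ≃ (Fin M → Fin 2 → Fin 2) where
  toFun a k t := a (finProdFinEquiv (k, t))
  invFun x i := x (finProdFinEquiv.symm i).1 (finProdFinEquiv.symm i).2
  left_inv a := by
    funext i
    simp only [Prod.mk.eta, Equiv.apply_symm_apply]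
  right_inv x := by
    funext k t
    simp only [Equiv.symm_apply_apply]

/-- Splitting of configurations. -/
def auxJoin (n m : ℕ) (h : m ≤ n) :
    (Fin m → Fin 2) × (Fin (n - m) → Fin 2) ≃ (Fin n → Fin 2) where
  toFun p := joinCfg n m p.1 p.2
  invFun σ := (fun i => σ ⟨i, by have := i.isLt; omega⟩,
    fun j => σ ⟨j + m, by have := j.isLt; omega⟩)
  left_inv p := by
    ext i
    · simp [joinCfg]
    · simp [joinCfg]
  right_inv σ := by
    funext i
    by_cases hi : (i : ℕ) < m
    · simp [joinCfg, hi]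
    · simp only [joinCfg, hi, dif_neg, not_false_eq_true]
      congr 1
      ext
      simp; omega

theorem aux_sum_join {n m : ℕ} (h : m ≤ n) (f : (Fin n → Fin 2) → ℂ) :
    ∑ σ, f σ = ∑ a, ∑ b, f (joinCfg n m a b) := by
  rw [← Fintype.sum_prod_type', ← (auxJoin n m h).sum_comp]
  rfl

theorem aux_join_lt {n M : ℕ} (s : Fin n) (l : Fin M) (t : Fin 2)
    (hs : (s : ℕ) = t + 2 * l) (a : Fin (M * 2) → Fin 2) (b : Fin (n - M * 2) → Fin 2) :
    joinCfg n (M * 2) a b s = auxPr M a l t := by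
  have hlt : (s : ℕ) < M * 2 := by have := l.isLt; have := t.isLt; omega
  simp only [joinCfg, hlt, dif_pos, auxPr, Equiv.coe_fn_mk]
  congr 1
  ext
  simp [finProdFinEquiv, hs]

theorem aux_join_ge {n M : ℕ} (s : Fin n) (j : Fin (n - M * 2))
    (hs : (s : ℕ) = j + M * 2) (a : Fin (M * 2) → Fin 2) (b : Fin (n - M * 2) → Fin 2) :
    joinCfg n (M * 2) a b s = b j := by
  have hlt : ¬ (s : ℕ) < M * 2 := by omega
  simp only [joinCfg, hlt, dif_neg, not_false_eq_true]
  congr 1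
  ext
  simp; omega

theorem aux_site_cases {n M : ℕ} (s : Fin n) :
    (∃ (l : Fin M) (t : Fin 2), (s : ℕ) = t + 2 * l) ∨
      (∃ j : Fin (n - M * 2), (s : ℕ) = j + M * 2) := by
  by_cases h : (s : ℕ) < M * 2
  · left
    exact ⟨⟨s / 2, by omega⟩, ⟨s % 2, by omega⟩, by simp; omega⟩
  · right
    have := s.isLt
    exact ⟨⟨s - M * 2, by omega⟩, by simp; omega⟩

/-- Tensor product of two-spin operators. -/
def auxT {M : ℕ} (A : Fin M → Matrix (Fin 2 → Fin 2) (Fin 2 → Fin 2) ℂ) :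
    Matrix (Fin (M * 2) → Fin 2) (Fin (M * 2) → Fin 2) ℂ :=
  fun a s => ∏ l, A l (auxPr M a l) (auxPr M s l)

theorem aux_sum_prod {R : Type} [CommSemiring R] {M : ℕ} (f : Fin M → (Fin 2 → Fin 2) → R) :
    ∑ a, ∏ l, f l (auxPr M a l) = ∏ l, ∑ c, f l c := by
  rw [(auxPr M).sum_comp (fun x => ∏ l, f l (x l)), Finset.prod_univ_sum, Fintype.piFinset_univ]

theorem auxT_mul {M : ℕ} (A B : Fin M → Matrix (Fin 2 → Fin 2) (Fin 2 → Fin 2) ℂ) :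
    auxT A * auxT B = auxT (fun l => A l * B l) := by
  ext a s
  simp only [Matrix.mul_apply, auxT, ← Finset.prod_mul_distrib]
  exact aux_sum_prod (fun l c => A l (auxPr M a l) c * B l c (auxPr M s l))

theorem auxT_star {M : ℕ} (A : Fin M → Matrix (Fin 2 → Fin 2) (Fin 2 → Fin 2) ℂ) :
    (auxT A)ᴴ = auxT (fun l => (A l)ᴴ) := by
  ext a s
  simp [auxT, Matrix.conjTranspose_apply]

theorem auxT_diag {M : ℕ} (d : Fin M → (Fin 2 → Fin 2) → ℂ) :
    auxT (fun l => Matrix.diagonal (d l)) =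
      Matrix.diagonal (fun s => ∏ l, d l (auxPr M s l)) := by
  ext a s
  by_cases h : a = s
  · subst h; simp [auxT]
  · rw [Matrix.diagonal_apply_ne _ h]
    have : auxPr M a ≠ auxPr M s := fun hh => h ((auxPr M).injective hh)
    obtain ⟨l, hl⟩ := Function.ne_iff.mp this
    exact Finset.prod_eq_zero (Finset.mem_univ l) (Matrix.diagonal_apply_ne _ hl)

theorem auxT_one {M : ℕ} : auxT (fun _ : Fin M => 1) = 1 := by
  have := auxT_diag (M := M) (fun _ _ => 1)
  simpa using this

theorem auxT_trace {M : ℕ} (A : Fin M → Matrix (Fin 2 → Fin 2) (Fin 2 → Fin 2) ℂ) :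
    (auxT A).trace = ∏ l, (A l).trace := by
  simp only [Matrix.trace, Matrix.diag_apply, auxT]
  exact aux_sum_prod (fun l c => A l c c)

theorem auxT_mulVec {M : ℕ} (A : Fin M → Matrix (Fin 2 → Fin 2) (Fin 2 → Fin 2) ℂ)
    (w : Fin M → (Fin 2 → Fin 2) → ℂ) :
    auxT A *ᵥ (fun a => ∏ l, w l (auxPr M a l)) = fun a => ∏ l, (A l *ᵥ w l) (auxPr M a l) := by
  ext a
  simp only [Matrix.mulVec, dotProduct, auxT, ← Finset.prod_mul_distrib]
  exact aux_sum_prod (fun l c => A l (auxPr M a l) c * w l c)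

theorem aux_local_form (n M : ℕ) (h : M * 2 ≤ n) (k : Fin M) (i : Fin n)
    (hi : (i : ℕ) = 2 * k) (H : QOp n) (hact : ActsOn {i, finSucc i} H) :
    ∃ g : Matrix (Fin 2 → Fin 2) (Fin 2 → Fin 2) ℂ,
      (∀ c c', ∃ σ τ, g c c' = H σ τ ∧ g c' c = H τ σ) ∧
      ∀ a b a' b', H (joinCfg n (M * 2) a b) (joinCfg n (M * 2) a' b') =
        if b = b' then auxT (fun l => if l = k then g else 1) a a' else 0 := by
  have hk := k.isLt
  have hsucc : ((finSucc i : Fin n) : ℕ) = 2 * k + 1 := by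
    simp only [finSucc]
    rw [hi, Nat.mod_eq_of_lt (by omega)]
  let P : (Fin 2 → Fin 2) → Fin n → Fin 2 := fun c =>
    joinCfg n (M * 2) ((auxPr M).symm (Function.update 0 k c)) 0
  have hmem : ∀ s : Fin n, s ∈ ({i, finSucc i} : Finset (Fin n)) ↔
      ((s : ℕ) = 2 * k ∨ (s : ℕ) = 2 * k + 1) := by
    intro s
    rw [Finset.mem_insert, Finset.mem_singleton, Fin.ext_iff, Fin.ext_iff, hi, hsucc]
  refine ⟨fun c c' => H (P c) (P c'), fun c c' => ⟨P c, P c', rfl, rfl⟩, ?_⟩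
  intro a b a' b'
  split_ifs with hb
  · subst hb
    by_cases hl : ∃ l, l ≠ k ∧ auxPr M a l ≠ auxPr M a' l
    · obtain ⟨l, hlk, hne⟩ := hl
      have hR : auxT (fun l => if l = k then
          (fun c c' => H (P c) (P c') : Matrix (Fin 2 → Fin 2) (Fin 2 → Fin 2) ℂ) else 1) a a' = 0 :=
        Finset.prod_eq_zero (Finset.mem_univ l) (by simp [hlk, hne])
      rw [hR]
      obtain ⟨t, ht⟩ := Function.ne_iff.mp hne
      have hll := l.isLt
      have htt := t.isLt
      refine hact.1 _ _ ⟨⟨t + 2 * l, by omega⟩, ?_, ?_⟩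
      · rw [hmem]
        have : (l : ℕ) ≠ k := fun hh => hlk (Fin.ext hh)
        simp only; omega
      · rw [aux_join_lt _ l t rfl, aux_join_lt _ l t rfl]; exact ht
    · push Not at hl
      have hR : auxT (fun l => if l = k then
          (fun c c' => H (P c) (P c') : Matrix (Fin 2 → Fin 2) (Fin 2 → Fin 2) ℂ) else 1) a a'
          = H (P (auxPr M a k)) (P (auxPr M a' k)) := by
        unfold auxT
        rw [Finset.prod_eq_single k]
        · simp
        · intro l _ hlk
          refine Eq.trans (congrFun (congrFun (if_neg hlk) _) _) ?_
          rw [hl l hlk, Matrix.one_apply_eq]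
        · simp
      rw [hR]
      have hin : ∀ a b, ∀ s ∈ ({i, finSucc i} : Finset (Fin n)),
          joinCfg n (M * 2) a b s = P (auxPr M a k) s := by
        intro a b s hs
        rw [hmem] at hs
        obtain ⟨t, ht⟩ : ∃ t : Fin 2, (s : ℕ) = t + 2 * k := by
          rcases hs with hs | hs
          · exact ⟨0, by simpa using hs⟩
          · exact ⟨1, by simp; omega⟩
        simp only [P]
        rw [aux_join_lt s k t ht, aux_join_lt s k t ht]
        simp
      refine hact.2 _ _ _ _ (hin a b) (hin a' b) ?_ ?_
      · intro s hs
        rw [hmem] at hs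
        rcases aux_site_cases (M := M) s with ⟨l, t, ht⟩ | ⟨j, hj⟩
        · rw [aux_join_lt s l t ht, aux_join_lt s l t ht, hl l]
          rintro rfl
          have := t.isLt
          omega
        · rw [aux_join_ge s j hj, aux_join_ge s j hj]
      · intro s hs
        rw [hmem] at hs
        simp only [P]
        rcases aux_site_cases (M := M) s with ⟨l, t, ht⟩ | ⟨j, hj⟩
        · rw [aux_join_lt s l t ht, aux_join_lt s l t ht]
          have : l ≠ k := by
            rintro rfl
            have := t.isLt
            omega
          simp [Function.update_of_ne this]
        · rw [aux_join_ge s j hj, aux_join_ge s j hj]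
  · obtain ⟨j, hj⟩ := Function.ne_iff.mp hb
    have hjj := j.isLt
    refine hact.1 _ _ ⟨⟨j + M * 2, by omega⟩, ?_, ?_⟩
    · rw [hmem]; simp only; omega
    · rw [aux_join_ge _ j rfl, aux_join_ge _ j rfl]; exact hj

theorem aux_local (n M : ℕ) (h : M * 2 ≤ n) (k : Fin M) (i : Fin n)
    (hi : (i : ℕ) = 2 * k) (H : QOp n) (hact : ActsOn {i, finSucc i} H)
    (hherm : H.IsHermitian) (htr : H.trace = 0) (hnorm : opNorm H = 1) :
    ∃ (g : Matrix (Fin 2 → Fin 2) (Fin 2 → Fin 2) ℂ) (hg : g.IsHermitian),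
      (∑ c, hg.eigenvalues c = 0) ∧ (∀ c, |hg.eigenvalues c| ≤ 1) ∧
      ∀ a b a' b', H (joinCfg n (M * 2) a b) (joinCfg n (M * 2) a' b') =
        if b = b' then auxT (fun l => if l = k then g else 1) a a' else 0 := by
  obtain ⟨g, hgH, hform⟩ := aux_local_form n M h k i hi H hact
  have hg : g.IsHermitian := by
    ext c c'
    obtain ⟨σ, τ, h1, h2⟩ := hgH c c'
    rw [conjTranspose_apply, h1, h2]
    exact hherm.apply σ τ
  refine ⟨g, hg, ?_, ?_, hform⟩
  · have h1 : H.trace = (2 ^ (n - M * 2) : ℂ) *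
        (auxT (fun l => if l = k then g else 1)).trace := by
      simp only [Matrix.trace, Matrix.diag_apply]
      rw [aux_sum_join h, Finset.mul_sum]
      refine Finset.sum_congr rfl fun a _ => ?_
      simp [hform]
    rw [htr, auxT_trace] at h1
    have h2 : g.trace = 0 := by
      have h3 := (mul_eq_zero.mp h1.symm).resolve_left (by positivity)
      obtain ⟨l, _, hl⟩ := Finset.prod_eq_zero_iff.mp h3
      split_ifs at hl with hlk
      · exact hl
      · simp at hl
    have h3 := hg.trace_eq_sum_eigenvalues
    rw [h2] at h3
    have h4 : ((∑ c, hg.eigenvalues c : ℝ) : ℂ) = 0 := by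
      push_cast
      exact h3.symm
    exact_mod_cast h4
  · intro c
    rw [← hnorm]
    set ε := hg.eigenvalues c with hε
    let u : (Fin 2 → Fin 2) → ℂ := (hg.eigenvectorBasis c).ofLp
    have hu : g *ᵥ u = (ε : ℂ) • u := by
      have := hg.mulVec_eigenvectorBasis c
      rw [this]; rfl
    have hu0 : u ≠ 0 := by
      intro h0
      have h1 := hg.eigenvectorBasis.orthonormal.ne_zero c
      exact h1 (by ext x; exact congrFun h0 x)
    let w : Fin M → (Fin 2 → Fin 2) → ℂ := fun l => if l = k then u else Pi.single 0 1
    let x : (Fin (M * 2) → Fin 2) → ℂ := fun a => ∏ l, w l (auxPr M a l)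
    let ψ : QState n := fun σ => if ((auxJoin n _ h).symm σ).2 = 0 then
      x ((auxJoin n _ h).symm σ).1 else 0
    have hψ : ∀ a b, ψ (joinCfg n (M * 2) a b) = if b = 0 then x a else 0 := by
      intro a b
      have : (auxJoin n _ h).symm (joinCfg n (M * 2) a b) = (a, b) :=
        (auxJoin n _ h).symm_apply_apply (a, b)
      simp only [ψ, this]
    have hx : auxT (fun l => if l = k then g else 1) *ᵥ x = (ε : ℂ) • x := by
      rw [auxT_mulVec]
      ext a
      have : ∀ l, ((if l = k then g else 1) *ᵥ w l) (auxPr M a l)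
          = (if l = k then (ε : ℂ) else 1) * w l (auxPr M a l) := by
        intro l
        by_cases hlk : l = k
        · simp [w, hlk, hu]
        · simp only [w, if_neg hlk, Matrix.one_mulVec, one_mul]
      simp only [this, Finset.prod_mul_distrib]
      simp [x]
    refine aux_opNorm H ε ψ ?_ ?_
    · obtain ⟨c0, hc0⟩ := Function.ne_iff.mp hu0
      intro h0
      have h1 := congrFun h0 (joinCfg n (M * 2) ((auxPr M).symm (Function.update 0 k c0)) 0)
      rw [hψ, if_pos rfl] at h1
      obtain ⟨l, _, hl⟩ := Finset.prod_eq_zero_iff.mp h1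
      by_cases hlk : l = k
      · subst hlk
        simp [w] at hl
        exact hc0 hl
      · simp [w, hlk] at hl
    · ext σ
      obtain ⟨⟨a, b⟩, rfl⟩ := (auxJoin n _ h).surjective σ
      change (H *ᵥ ψ) (joinCfg n (M * 2) a b) = (ε : ℂ) * ψ (joinCfg n (M * 2) a b)
      rw [hψ, Matrix.mulVec, dotProduct, aux_sum_join h]
      simp only [hform, hψ]
      by_cases hb : b = 0
      · subst hb
        have := congrFun hx a
        simp only [Matrix.mulVec, dotProduct, Pi.smul_apply, smul_eq_mul] at this
        simp [this]
      · simp [hb]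

theorem aux_eig {ι : Type} [Fintype ι] [DecidableEq ι] {g : Matrix ι ι ℂ} (hg : g.IsHermitian) :
    ∃ u : Matrix ι ι ℂ, uᴴ * u = 1 ∧
      uᴴ * g * u = Matrix.diagonal (fun c => (hg.eigenvalues c : ℂ)) := by
  refine ⟨hg.eigenvectorUnitary, ?_, ?_⟩
  · have := Unitary.coe_star_mul_self hg.eigenvectorUnitary
    simpa [Matrix.star_eq_conjTranspose] using this
  · have h1 : (hg.eigenvectorUnitary : Matrix ι ι ℂ)ᴴ * hg.eigenvectorUnitary = 1 := by
      have := Unitary.coe_star_mul_self hg.eigenvectorUnitary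
      simpa [Matrix.star_eq_conjTranspose] using this
    have h2 := hg.spectral_theorem
    rw [Unitary.conjStarAlgAut_apply, Matrix.star_eq_conjTranspose] at h2
    set Φ : Matrix ι ι ℂ := (hg.eigenvectorUnitary : Matrix ι ι ℂ) with hΦ
    have h3 : g = Φ * Matrix.diagonal (fun c => (hg.eigenvalues c : ℂ)) * Φᴴ := h2
    calc Φᴴ * g * Φ
        = Φᴴ * (Φ * Matrix.diagonal (fun c => (hg.eigenvalues c : ℂ)) * Φᴴ) * Φ := by rw [← h3]
      _ = (Φᴴ * Φ) * Matrix.diagonal (fun c => (hg.eigenvalues c : ℂ)) * (Φᴴ * Φ) := by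
          simp only [Matrix.mul_assoc]
      _ = _ := by rw [h1, Matrix.one_mul, Matrix.mul_one]

theorem aux_state (n M : ℕ) (h : M * 2 ≤ n) (ψ : QState n)
    (hψ : ∑ σ, (starRingEnd ℂ) (ψ σ) * ψ σ = 1) (e : ℝ) (H : Fin M → QOp n)
    (g : Fin M → Matrix (Fin 2 → Fin 2) (Fin 2 → Fin 2) ℂ) (hg : ∀ k, (g k).IsHermitian)
    (hsum : ∀ k, ∑ c, (hg k).eigenvalues c = 0) (hle : ∀ k c, |(hg k).eigenvalues c| ≤ 1)
    (hform : ∀ k a b a' b', H k (joinCfg n (M * 2) a b) (joinCfg n (M * 2) a' b') =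
        if b = b' then auxT (fun l => if l = k then g k else 1) a a' else 0)
    (he : ∀ k, ∑ σ, ∑ τ, (starRingEnd ℂ) (ψ σ) * H k σ τ * ψ τ = (e : ℂ)) :
    entEntropy n (M * 2) ψ ≤ M * (2 * Real.log 2) - M * e ^ 2 / 2 := by
  set ρ := rdm n (M * 2) ψ with hρdef
  have hρ : ρ.PosSemidef := by
    let B : Matrix (Fin (M * 2) → Fin 2) (Fin (n - M * 2) → Fin 2) ℂ :=
      fun a b => ψ (joinCfg n (M * 2) a b)
    have : ρ = B * Bᴴ := by
      ext a a'
      rw [Matrix.mul_apply]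
      rfl
    rw [this]
    exact Matrix.posSemidef_self_mul_conjTranspose B
  have htr : ρ.trace = 1 := by
    rw [← hψ, aux_sum_join h]
    simp only [Matrix.trace, Matrix.diag_apply, hρdef, rdm]
    refine Finset.sum_congr rfl fun a _ => Finset.sum_congr rfl fun b _ => mul_comm _ _
  have htrK : ∀ k, (ρ * auxT (fun l => if l = k then g k else 1)).trace = (e : ℂ) := by
    intro k
    rw [← he k, Matrix.trace_mul_comm, aux_sum_join h]
    simp only [Matrix.trace, Matrix.diag_apply, Matrix.mul_apply]
    refine Finset.sum_congr rfl fun a _ => ?_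
    simp only [aux_sum_join h, hform, hρdef, rdm]
    rw [Finset.sum_comm]
    refine Finset.sum_congr rfl fun a' _ => ?_
    rw [Finset.mul_sum]
    refine Finset.sum_congr rfl fun b _ => ?_
    simp
    ring
  choose u hu1 hu2 using fun k => aux_eig (hg k)
  have hU1 : (auxT u)ᴴ * auxT u = 1 := by
    rw [auxT_star, auxT_mul]
    simp only [hu1]
    exact auxT_one
  have hU2 : auxT u * (auxT u)ᴴ = 1 := mul_eq_one_comm.mp hU1
  have hUK : ∀ k, (auxT u)ᴴ * auxT (fun l => if l = k then g k else 1) * auxT u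
      = Matrix.diagonal (fun s => ((hg k).eigenvalues (auxPr M s k) : ℂ)) := by
    intro k
    rw [auxT_star, auxT_mul, auxT_mul]
    have : (fun l => (u l)ᴴ * (if l = k then g k else 1) * u l)
        = fun l => Matrix.diagonal
          (fun c => if l = k then ((hg k).eigenvalues c : ℂ) else 1) := by
      funext l
      by_cases hlk : l = k
      · subst hlk; simp [hu2]
      · simp [hlk, hu1]
    rw [this, auxT_diag]
    simp
  set Q := (auxT u)ᴴ * ρ * auxT u with hQ
  have hQtr : ∑ s, (Q s s).re = 1 := by
    have h1 : Q.trace = 1 := by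
      rw [hQ, Matrix.trace_mul_comm, ← Matrix.mul_assoc, hU2, Matrix.one_mul, htr]
    have h2 := congrArg Complex.re h1
    simpa [Matrix.trace] using h2
  have hQe : ∀ k, ∑ s, (Q s s).re * (hg k).eigenvalues (auxPr M s k) = e := by
    intro k
    have h1 : (Q * Matrix.diagonal
        (fun s => ((hg k).eigenvalues (auxPr M s k) : ℂ))).trace = (e : ℂ) := by
      rw [← hUK k, hQ, ← htrK k]
      set K := auxT (fun l => if l = k then g k else 1)
      calc ((auxT u)ᴴ * ρ * auxT u * ((auxT u)ᴴ * K * auxT u)).trace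
          = ((auxT u)ᴴ * (ρ * (auxT u * (auxT u)ᴴ) * K * auxT u)).trace := by
            simp only [Matrix.mul_assoc]
        _ = (ρ * (auxT u * (auxT u)ᴴ) * K * (auxT u * (auxT u)ᴴ)).trace := by
            rw [Matrix.trace_mul_comm, Matrix.mul_assoc]
        _ = _ := by rw [hU2, Matrix.mul_one, Matrix.mul_one]
    have h2 := congrArg Complex.re h1
    simpa [Matrix.trace, Matrix.mul_diagonal] using h2
  let r : (Fin (M * 2) → Fin 2) → ℝ := fun s =>
    ∏ k, Real.exp (e * (hg k).eigenvalues (auxPr M s k) - e ^ 2 / 2 - Real.log 4)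
  have hr : ∀ s, 0 < r s := fun s => Finset.prod_pos fun k _ => Real.exp_pos _
  have hr1 : ∑ s, r s ≤ 1 := by
    have := aux_sum_prod (M := M)
      (fun k c => Real.exp (e * (hg k).eigenvalues c - e ^ 2 / 2 - Real.log 4))
    simp only [r]
    rw [this]
    refine Finset.prod_le_one (fun k _ => Finset.sum_nonneg fun c _ => (Real.exp_pos _).le) ?_
    intro k _
    exact aux_hoeff (by simp) _ (hsum k) (hle k) e
  have hlog : ∀ s, Real.log (r s) =
      e * (∑ k, (hg k).eigenvalues (auxPr M s k)) - M * (e ^ 2 / 2 + Real.log 4) := by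
    intro s
    simp only [r]
    rw [← Real.exp_sum, Real.log_exp, Finset.sum_sub_distrib, Finset.sum_sub_distrib,
      Finset.mul_sum]
    simp
    ring
  have hmain := aux_entropy_le ρ hρ htr (auxT u) hU1 r hr hr1
  have hcalc : ∑ s, (Q s s).re * Real.log (r s)
      = e * (M * e) - M * (e ^ 2 / 2 + Real.log 4) := by
    simp only [hlog, mul_sub, Finset.sum_sub_distrib]
    rw [← Finset.sum_mul, hQtr, one_mul]
    congr 1
    have : ∀ s, (Q s s).re * (e * ∑ k, (hg k).eigenvalues (auxPr M s k))
        = e * ∑ k, (Q s s).re * (hg k).eigenvalues (auxPr M s k) := by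
      intro s
      rw [← Finset.mul_sum]; ring
    simp only [this]
    rw [← Finset.mul_sum, Finset.sum_comm]
    simp [hQe]
  have hl4 : Real.log 4 = 2 * Real.log 2 := by
    rw [show (4 : ℝ) = 2 ^ 2 by norm_num, Real.log_pow]; norm_num
  rw [hcalc, hl4] at hmain
  unfold entEntropy
  linarith

theorem aux_finSucc_bij {n : ℕ} : Function.Bijective (finSucc : Fin n → Fin n) := by
  rw [Function.Bijective, and_iff_left_of_imp (Finite.surjective_of_injective)]
  intro i j hij
  have h := congrArg Fin.val hij
  simp only [finSucc] at h
  have hi := i.isLt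
  have hj := j.isLt
  have h2 : (i : ℕ) ≡ j [MOD n] := Nat.ModEq.add_right_cancel' 1 h
  ext
  exact Nat.ModEq.eq_of_lt_of_lt h2 hi hj

theorem aux_shift_bij {n : ℕ} : Function.Bijective (shiftCfg : (Fin n → Fin 2) → _) := by
  rw [Function.Bijective, and_iff_left_of_imp (Finite.surjective_of_injective)]
  intro σ τ h
  funext i
  obtain ⟨j, rfl⟩ := aux_finSucc_bij.2 i
  exact congrFun h j

theorem aux_const {n : ℕ} (hn : 0 < n) {α : Type} (f : Fin n → α)
    (h : ∀ i, f (finSucc i) = f i) : ∀ i, f i = f ⟨0, hn⟩ := by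
  rintro ⟨i, hi⟩
  induction i with
  | zero => rfl
  | succ i ih =>
    rw [← ih (by omega), ← h ⟨i, by omega⟩]
    congr 1
    ext
    simp [finSucc, Nat.mod_eq_of_lt hi]

theorem aux_expect_TI {n : ℕ} (H H' : QOp n)
    (hH : ∀ σ τ, H' σ τ = H (shiftCfg σ) (shiftCfg τ)) (ψ : QState n)
    (hψ : ∑ σ, (starRingEnd ℂ) (ψ σ) * ψ σ = 1) (c : ℂ)
    (hc : ∀ σ, ψ (shiftCfg σ) = c * ψ σ) :
    ∑ σ, ∑ τ, (starRingEnd ℂ) (ψ σ) * H' σ τ * ψ τ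
      = ∑ σ, ∑ τ, (starRingEnd ℂ) (ψ σ) * H σ τ * ψ τ := by
  have hc1 : (starRingEnd ℂ) c * c = 1 := by
    have h1 := aux_shift_bij.sum_comp (fun σ => (starRingEnd ℂ) (ψ σ) * ψ σ)
    simp only [hc, map_mul] at h1
    rw [hψ] at h1
    rw [← h1, ← mul_one ((starRingEnd ℂ) c * c), ← hψ, Finset.mul_sum]
    exact Finset.sum_congr rfl fun σ _ => by ring
  rw [← aux_shift_bij.sum_comp (fun σ => ∑ τ, (starRingEnd ℂ) (ψ σ) * H σ τ * ψ τ)]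
  refine Finset.sum_congr rfl fun σ _ => ?_
  rw [← aux_shift_bij.sum_comp (fun τ => (starRingEnd ℂ) (ψ (shiftCfg σ)) * H (shiftCfg σ) τ * ψ τ)]
  refine Finset.sum_congr rfl fun τ _ => ?_
  rw [hc, hc, hH, map_mul]
  linear_combination (-(starRingEnd ℂ) (ψ σ) * H (shiftCfg σ) (shiftCfg τ) * ψ τ) * hc1

theorem aux_trace_sq {n : ℕ} (H : QOp n) (v : (Fin n → Fin 2) → QState n)
    (E : (Fin n → Fin 2) → ℝ)
    (hON : ∀ j j', ∑ σ, (starRingEnd ℂ) (v j σ) * v j' σ = if j = j' then 1 else 0)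
    (heig : ∀ j, H.mulVec (v j) = (E j : ℂ) • v j) :
    (H * H).trace = ((∑ j, E j ^ 2 : ℝ) : ℂ) := by
  let V : QOp n := fun σ j => v j σ
  have hV1 : Vᴴ * V = 1 := by
    ext j j'
    rw [Matrix.mul_apply, Matrix.one_apply, ← hON j j']
    rfl
  have hV2 : V * Vᴴ = 1 := mul_eq_one_comm.mp hV1
  have hHV : H * V = V * Matrix.diagonal (fun j => (E j : ℂ)) := by
    ext σ j
    rw [Matrix.mul_diagonal, Matrix.mul_apply]
    have := congrFun (heig j) σ
    simp only [Matrix.mulVec, dotProduct, Pi.smul_apply, smul_eq_mul] at this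
    simp only [V]
    rw [this, mul_comm]
  have h1 : H * H * V = V * (Matrix.diagonal (fun j => (E j : ℂ)) *
      Matrix.diagonal (fun j => (E j : ℂ))) := by
    rw [Matrix.mul_assoc, hHV, ← Matrix.mul_assoc, hHV, Matrix.mul_assoc]
  calc (H * H).trace = (H * H * V * Vᴴ).trace := by
        rw [Matrix.mul_assoc _ V, hV2, Matrix.mul_one]
    _ = (Vᴴ * (H * H * V)).trace := Matrix.trace_mul_comm _ _
    _ = _ := by
      rw [h1, ← Matrix.mul_assoc, hV1, Matrix.one_mul, Matrix.diagonal_mul_diagonal,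
        Matrix.trace_diagonal]
      push_cast
      exact Finset.sum_congr rfl fun j _ => by ring

/-- **Theorem 2 (average eigenstate entanglement bound).** In the translationally invariant
spin-chain setting, the average entanglement entropy of all `d = 2^n` eigenstates over the
first `m` spins satisfies `S̄ ≤ m ln 2 - f ⟨H₁²⟩ / 4`, where `f = m/n ≤ 1/2`, `m` is even, and
`⟨X⟩ = d⁻¹ tr X` is the infinite-temperature expectation value. -/
theorem average_eigenstate_entanglement_upper_bound
    (n m : ℕ) (hn : 0 < n) (hmeven : Even m) (hmn : 2 * m ≤ n)
    (H1 H2 : Fin n → QOp n)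
    (hloc1 : ∀ i, ActsOn {i} (H1 i))
    (hloc2 : ∀ i, ActsOn {i, finSucc i} (H2 i))
    (hherm1 : ∀ i, (H1 i).IsHermitian) (hherm2 : ∀ i, (H2 i).IsHermitian)
    (htr1 : ∀ i, (H1 i).trace = 0) (htr2 : ∀ i, (H2 i).trace = 0)
    (horth : ∀ i i', i ≠ i' → ((H1 i + H2 i) * (H1 i' + H2 i')).trace = 0)
    (hnorm : ∀ i, opNorm (H1 i + H2 i) = 1)
    (hTIH1 : ∀ i σ τ, H1 (finSucc i) σ τ = H1 i (shiftCfg σ) (shiftCfg τ))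
    (hTIH2 : ∀ i σ τ, H2 (finSucc i) σ τ = H2 i (shiftCfg σ) (shiftCfg τ))
    (v : (Fin n → Fin 2) → QState n) (E : (Fin n → Fin 2) → ℝ)
    (hON : ∀ j j', ∑ σ, (starRingEnd ℂ) (v j σ) * v j' σ = if j = j' then 1 else 0)
    (heig : ∀ j, (∑ i, (H1 i + H2 i)).mulVec (v j) = (E j : ℂ) • v j)
    (hTIv : ∀ j, ∃ c : ℂ, ∀ σ, v j (shiftCfg σ) = c * v j σ) :
    (2 ^ n : ℝ)⁻¹ * ∑ j, entEntropy n m (v j)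
      ≤ m * Real.log 2 -
        ((m : ℝ) / n) *
          ((((H1 ⟨0, hn⟩ + H2 ⟨0, hn⟩) * (H1 ⟨0, hn⟩ + H2 ⟨0, hn⟩)).trace).re / 2 ^ n) / 4 := by
  set H : Fin n → QOp n := fun i => H1 i + H2 i with hHdef
  have hTI : ∀ i σ τ, H (finSucc i) σ τ = H i (shiftCfg σ) (shiftCfg τ) := by
    intro i σ τ
    simp [hHdef, hTIH1, hTIH2]
  have hact : ∀ i, ActsOn {i, finSucc i} (H i) := fun i =>
    aux_acts_add (aux_acts_mono (by simp) (hloc1 i)) (hloc2 i)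
  have hherm : ∀ i, (H i).IsHermitian := fun i => (hherm1 i).add (hherm2 i)
  have htr : ∀ i, (H i).trace = 0 := fun i => by
    simp [hHdef, Matrix.trace_add, htr1, htr2]
  have hn0 : (n : ℝ) ≠ 0 := by positivity
  have hnC : (n : ℂ) ≠ 0 := by exact_mod_cast hn.ne'
  have hnormv : ∀ j, ∑ σ, (starRingEnd ℂ) (v j σ) * v j σ = 1 := fun j => by
    simpa using hON j j
  -- local expectation values
  have hexp : ∀ j i, ∑ σ, ∑ τ, (starRingEnd ℂ) (v j σ) * H i σ τ * v j τ
      = ((E j / n : ℝ) : ℂ) := by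
    intro j
    obtain ⟨c, hc⟩ := hTIv j
    have h1 := aux_const hn (fun i => ∑ σ, ∑ τ, (starRingEnd ℂ) (v j σ) * H i σ τ * v j τ)
      (fun i => aux_expect_TI (H i) (H (finSucc i)) (hTI i) (v j) (hnormv j) c hc)
    have h2 : ∑ i, ∑ σ, ∑ τ, (starRingEnd ℂ) (v j σ) * H i σ τ * v j τ = (E j : ℂ) := by
      have h3 : ∀ σ, ∑ τ, (∑ i, H i σ τ) * v j τ = (E j : ℂ) * v j σ := by
        intro σ
        have := congrFun (heig j) σ
        simpa [Matrix.mulVec, dotProduct, Matrix.sum_apply] using this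
      rw [Finset.sum_comm]
      calc _ = ∑ σ, (starRingEnd ℂ) (v j σ) * ∑ τ, (∑ i, H i σ τ) * v j τ := by
            refine Finset.sum_congr rfl fun σ _ => ?_
            rw [Finset.sum_comm, Finset.mul_sum]
            refine Finset.sum_congr rfl fun τ _ => ?_
            rw [Finset.sum_mul, Finset.mul_sum]
            exact Finset.sum_congr rfl fun i _ => by ring
        _ = (E j : ℂ) * ∑ σ, (starRingEnd ℂ) (v j σ) * v j σ := by
            rw [Finset.mul_sum]
            refine Finset.sum_congr rfl fun σ _ => ?_
            rw [h3]; ring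
        _ = _ := by rw [hnormv, mul_one]
    intro i
    have h4 : (n : ℂ) * ∑ σ, ∑ τ, (starRingEnd ℂ) (v j σ) * H i σ τ * v j τ = (E j : ℂ) := by
      rw [← h2, Finset.sum_congr rfl (fun i' _ => (h1 i').trans (h1 i).symm)]
      simp
    push_cast
    rw [eq_div_iff hnC, mul_comm]
    exact h4
  -- traces
  have hsq : ((∑ j, E j ^ 2 : ℝ) : ℂ) = n * (H ⟨0, hn⟩ * H ⟨0, hn⟩).trace := by
    rw [← aux_trace_sq (∑ i, H i) v E hON heig, Finset.sum_mul_sum, Matrix.trace_sum]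
    have h1 := aux_const hn (fun i => (H i * H i).trace) (fun i => by
      simp only [Matrix.trace, Matrix.diag_apply, Matrix.mul_apply, hTI]
      rw [← aux_shift_bij.sum_comp (fun σ => ∑ τ, H i σ τ * H i τ σ)]
      refine Finset.sum_congr rfl fun σ _ => ?_
      rw [← aux_shift_bij.sum_comp (fun τ => H i (shiftCfg σ) τ * H i τ (shiftCfg σ))])
    have h2 : ∀ i, (∑ i', H i * H i').trace = (H ⟨0, hn⟩ * H ⟨0, hn⟩).trace := by
      intro i
      rw [Matrix.trace_sum, Finset.sum_eq_single i]
      · exact h1 i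
      · intro i' _ hne
        exact horth i i' (Ne.symm hne)
      · simp
    simp [h2]
  have hsqr : ∑ j, E j ^ 2 = n * ((H ⟨0, hn⟩ * H ⟨0, hn⟩).trace).re := by
    have := congrArg Complex.re hsq
    rw [Complex.ofReal_re] at this
    rw [this]
    simp
  obtain ⟨M, rfl⟩ : ∃ M, m = M * 2 := by
    obtain ⟨r, hr⟩ := hmeven
    exact ⟨r, by omega⟩
  have hMn : M * 2 ≤ n := by omega
  let site : Fin M → Fin n := fun k => ⟨2 * k, by have := k.isLt; omega⟩
  choose g hg hsum hle hform using fun k : Fin M =>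
    aux_local n M hMn k (site k) rfl (H (site k)) (hact _) (hherm _) (htr _) (hnorm _)
  have hS : ∀ j, entEntropy n (M * 2) (v j)
      ≤ M * (2 * Real.log 2) - M * (E j / n) ^ 2 / 2 := fun j =>
    aux_state n M hMn (v j) (hnormv j) (E j / n) (fun k => H (site k)) g hg hsum hle hform
      (fun k => hexp j (site k))
  have hS2 : ∑ j, entEntropy n (M * 2) (v j)
      ≤ 2 ^ n * (M * (2 * Real.log 2)) - M / (2 * n ^ 2) * ∑ j, E j ^ 2 := by
    refine (Finset.sum_le_sum fun j _ => hS j).trans (le_of_eq ?_)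
    rw [Finset.sum_sub_distrib, Finset.mul_sum]
    congr 1
    · simp
    · refine Finset.sum_congr rfl fun j _ => ?_
      field_simp
  rw [hsqr] at hS2
  calc (2 ^ n : ℝ)⁻¹ * ∑ j, entEntropy n (M * 2) (v j)
      ≤ (2 ^ n : ℝ)⁻¹ * (2 ^ n * (M * (2 * Real.log 2)) - M / (2 * n ^ 2) *
        (n * ((H ⟨0, hn⟩ * H ⟨0, hn⟩).trace).re)) := by gcongr
    _ = _ := by
      push_cast
      field_simp
      ring
end
end

section
/- Without translational invariance, suppose ‖H_i‖ ≤ C for all i with some constant C > 0 and each H_i is traceless. Let S̄̄ denote the average, over all d eigenstates |j⟩ of H and over all n consecutive regions A of length m (with m even, f := m/n ≤ 1/2), of the entanglement entropy S(ρ_{j,A}). Then S̄̄ ≤ m·ln 2 − (f/(4nC²)) Σ_{i=1}^n ⟨H_i²⟩; in particular if ⟨H_i²⟩ = Θ(1) for all i, then S̄̄ ≤ m·ln 2 − Θ(f). -/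
open Finset Matrix
open scoped ComplexOrder

noncomputable section

/-- Shift a state cyclically by `s` sites: site `j` of the shifted state carries what was on
site `j + s` of the original state, so the first `m` spins of the shifted state are the
consecutive region `{s, s+1, …, s+m-1}` (mod `n`) of the original state. -/
def shiftState (n : ℕ) (s : Fin n) (ψ : QState n) : QState n :=
  fun σ => ψ (fun i => σ (i - s))

theorem simdiag {ι κ : Type} [Fintype ι] [DecidableEq ι]
    (h : κ → Matrix ι ι ℂ) (hh : ∀ l, (h l).IsHermitian)
    (hc : ∀ l l', l ≠ l' → h l * h l' = h l' * h l) :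
    ∃ (W : Matrix ι ι ℂ) (e : κ → ι → ℝ), Wᴴ * W = 1 ∧ W * Wᴴ = 1 ∧
      ∀ l, h l = W * diagonal (fun a => (e l a : ℂ)) * Wᴴ := by
  classical
  let T : κ → (EuclideanSpace ℂ ι →ₗ[ℂ] EuclideanSpace ℂ ι) := fun l => Matrix.toEuclideanLin (h l)
  have hT : ∀ l, (T l).IsSymmetric := fun l => Matrix.isSymmetric_toEuclideanLin_iff.mpr (hh l)
  have hC : Pairwise (Function.onFun Commute T) := by
    intro l l' hl
    have := hc l l' hl
    show T l * T l' = T l' * T l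
    ext x : 1
    simp only [T, Module.End.mul_apply]
    rw [Matrix.toLpLin_apply, Matrix.toLpLin_apply, Matrix.toLpLin_apply, Matrix.toLpLin_apply]
    simp [this]
  have hI := LinearMap.IsSymmetric.directSum_isInternal_of_pairwise_commute hT hC
  have hO := LinearMap.IsSymmetric.orthogonalFamily_iInf_eigenspaces hT
  have hI' := DirectSum.isInternal_ne_bot_iff.mpr hI
  have hO' := hO.comp (γ := {α : κ → ℂ // (⨅ j, Module.End.eigenspace (T j) (α j)) ≠ ⊥})
    (f := Subtype.val) Subtype.val_injective
  have : Finite {α : κ → ℂ // (⨅ j, Module.End.eigenspace (T j) (α j)) ≠ ⊥} := by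
    have := hI.submodule_iSupIndep.fintypeNeBotOfFiniteDimensional
    infer_instance
  have := Fintype.ofFinite {α : κ → ℂ // (⨅ j, Module.End.eigenspace (T j) (α j)) ≠ ⊥}
  have hn : Module.finrank ℂ (EuclideanSpace ℂ ι) = Fintype.card ι := by simp
  let b := (hI'.subordinateOrthonormalBasis hn hO').reindex (Fintype.equivFin ι).symm
  let μ : ι → κ → ℂ := fun a => (hI'.subordinateOrthonormalBasisIndex hn (Fintype.equivFin ι a) hO').1
  have hb : ∀ a l, T l (b a) = μ a l • b a := by
    intro a l
    have := hI'.subordinateOrthonormalBasis_subordinate hn (Fintype.equivFin ι a) hO'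
    have := (Submodule.mem_iInf _).mp this l
    rw [Module.End.mem_eigenspace_iff] at this
    simpa [b, μ] using this
  have hreal : ∀ a l, ((μ a l).re : ℂ) = μ a l := by
    intro a l
    have hev : Module.End.HasEigenvalue (T l) (μ a l) :=
      Module.End.hasEigenvalue_of_hasEigenvector (x := b a)
        ⟨Module.End.mem_eigenspace_iff.mpr (hb a l), b.orthonormal.ne_zero a⟩
    exact Complex.conj_eq_iff_re.mp ((hT l).conj_eigenvalue_eq_self hev)
  let W : Matrix ι ι ℂ := fun i a => b a i
  have hW : Wᴴ * W = 1 := by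
    ext a a'
    have := (orthonormal_iff_ite.mp b.orthonormal) a a'
    rw [Matrix.one_apply, ← this, Matrix.mul_apply, PiLp.inner_apply]
    refine Finset.sum_congr rfl fun i _ => ?_
    rw [Matrix.conjTranspose_apply]
    simp [W, mul_comm]
  have hW' : W * Wᴴ = 1 := mul_eq_one_comm.mp hW
  refine ⟨W, fun l a => (μ a l).re, hW, hW', fun l => ?_⟩
  have key : h l * W = W * diagonal (fun a => (((μ a l).re : ℝ) : ℂ)) := by
    ext i a
    have := congrArg (fun x : EuclideanSpace ℂ ι => x i) (hb a l)
    simp only [T, Matrix.toLpLin_apply] at this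
    rw [Matrix.mul_diagonal, hreal, mul_comm]
    simpa [Matrix.mul_apply, Matrix.mulVec, dotProduct] using this
  rw [← key, Matrix.mul_assoc, hW', Matrix.mul_one]

theorem gibbs_ptwise (p k Z : ℝ) (hp : 0 ≤ p) (hZ : 0 < Z) :
    p * (k - Real.log Z - Real.log p) ≤ Real.exp k / Z - p := by
  rcases hp.eq_or_lt with h0 | h0
  · rw [← h0]; simp; positivity
  · have h1 := Real.add_one_le_exp (k - Real.log Z - Real.log p)
    rw [Real.exp_sub, Real.exp_sub, Real.exp_log hZ, Real.exp_log h0] at h1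
    have := mul_le_mul_of_nonneg_left h1 hp
    have e : p * (Real.exp k / Z / p) = Real.exp k / Z := by field_simp
    rw [e] at this
    linarith

theorem gibbs_matrix {ι : Type} [Fintype ι] [DecidableEq ι] [Nonempty ι] (ρ : Matrix ι ι ℂ)
    (hρ : ρ.PosSemidef) (htr : ρ.trace = 1) (W : Matrix ι ι ℂ) (hW : Wᴴ * W = 1)
    (hW' : W * Wᴴ = 1) (k : ι → ℝ) :
    vnEntropy ρ + (ρ * (W * diagonal (fun a => (k a : ℂ)) * Wᴴ)).trace.re
      ≤ Real.log (∑ a, Real.exp (k a)) := by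
  have hH := hρ.isHermitian
  set p := hH.eigenvalues with hpdef
  have hp : ∀ i, 0 ≤ p i := hρ.eigenvalues_nonneg
  have hsum : ∑ i, p i = 1 := by
    have := hH.trace_eq_sum_eigenvalues
    rw [htr] at this
    have h2 : ((∑ i, p i : ℝ) : ℂ) = 1 := by rw [this]; push_cast; rfl
    exact_mod_cast h2
  have hS : vnEntropy ρ = -∑ i, p i * Real.log (p i) := by
    unfold vnEntropy
    rw [dif_pos hH]
  let U : Matrix ι ι ℂ := (hH.eigenvectorUnitary : Matrix ι ι ℂ)
  have hU : Uᴴ * U = 1 := by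
    have := Unitary.coe_star_mul_self hH.eigenvectorUnitary
    simpa [U, Matrix.star_eq_conjTranspose] using this
  have hU' : U * Uᴴ = 1 := mul_eq_one_comm.mp hU
  have hspec : ρ = U * diagonal (fun i => (p i : ℂ)) * Uᴴ := by
    have := hH.spectral_theorem
    rw [Unitary.conjStarAlgAut_apply] at this
    exact this
  let Q : Matrix ι ι ℂ := Wᴴ * U
  have hQ : Qᴴ * Q = 1 := by
    simp only [Q, conjTranspose_mul, conjTranspose_conjTranspose]
    rw [Matrix.mul_assoc, ← Matrix.mul_assoc W, hW', Matrix.one_mul, hU]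
  have hQ' : Q * Qᴴ = 1 := mul_eq_one_comm.mp hQ
  let D : ι → ι → ℝ := fun a i => Complex.normSq (Q a i)
  have hD : ∀ a i, 0 ≤ D a i := fun a i => Complex.normSq_nonneg _
  have hDr : ∀ a, ∑ i, D a i = 1 := by
    intro a
    have := congrFun (congrFun hQ' a) a
    rw [Matrix.mul_apply, Matrix.one_apply_eq] at this
    have h2 : ∑ i, ((D a i : ℝ) : ℂ) = 1 := by
      rw [← this]
      refine Finset.sum_congr rfl fun i _ => ?_
      simp [D, Complex.mul_conj]
    exact_mod_cast h2
  have hDc : ∀ i, ∑ a, D a i = 1 := by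
    intro a
    have := congrFun (congrFun hQ a) a
    rw [Matrix.mul_apply, Matrix.one_apply_eq] at this
    have h2 : ∑ i, ((D i a : ℝ) : ℂ) = 1 := by
      rw [← this]
      refine Finset.sum_congr rfl fun i _ => ?_
      simp [D, Complex.normSq_eq_conj_mul_self]
    exact_mod_cast h2
  have htrace : (ρ * (W * diagonal (fun a => (k a : ℂ)) * Wᴴ)).trace.re
      = ∑ i, ∑ a, p i * k a * D a i := by
    have e1 : (ρ * (W * diagonal (fun a => (k a : ℂ)) * Wᴴ)).trace
        = (diagonal (fun i => (p i : ℂ)) * (Qᴴ * (diagonal (fun a => (k a : ℂ)) * Q))).trace := by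
      rw [hspec]
      rw [Matrix.mul_assoc, Matrix.mul_assoc, Matrix.trace_mul_comm]
      simp only [Q, conjTranspose_mul, conjTranspose_conjTranspose, Matrix.mul_assoc]
    have e2 : (diagonal (fun i => (p i : ℂ)) * (Qᴴ * (diagonal (fun a => (k a : ℂ)) * Q))).trace
        = ((∑ i, ∑ a, p i * k a * D a i : ℝ) : ℂ) := by
      rw [Matrix.trace]
      push_cast
      refine Finset.sum_congr rfl fun i _ => ?_
      rw [Matrix.diag_apply, Matrix.diagonal_mul, Matrix.mul_apply, Finset.mul_sum]
      refine Finset.sum_congr rfl fun a _ => ?_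
      rw [Matrix.diagonal_mul, conjTranspose_apply]
      simp only [D, Complex.normSq_eq_conj_mul_self]
      simp only [RCLike.star_def]
      ring
    rw [e1, e2, Complex.ofReal_re]
  set Z := ∑ a, Real.exp (k a) with hZdef
  have hZ : 0 < Z := Finset.sum_pos (fun a _ => Real.exp_pos _) Finset.univ_nonempty
  have main : ∑ i, ∑ a, D a i * (p i * (k a - Real.log Z - Real.log (p i))) ≤
      ∑ i, ∑ a, D a i * (Real.exp (k a) / Z - p i) :=
    Finset.sum_le_sum fun i _ => Finset.sum_le_sum fun a _ =>
      mul_le_mul_of_nonneg_left (gibbs_ptwise _ _ _ (hp i) hZ) (hD a i)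
  have rhs : ∑ i, ∑ a, D a i * (Real.exp (k a) / Z - p i) = 0 := by
    simp only [mul_sub, Finset.sum_sub_distrib]
    rw [Finset.sum_comm]
    simp only [← Finset.sum_mul, hDr, hDc, one_mul]
    rw [← Finset.sum_div, hsum, ← hZdef, div_self hZ.ne', sub_self]
  have lhs : ∑ i, ∑ a, D a i * (p i * (k a - Real.log Z - Real.log (p i))) =
      ∑ i, ∑ a, p i * k a * D a i - Real.log Z - ∑ i, p i * Real.log (p i) := by
    have : ∀ i, ∑ a, D a i * (p i * (k a - Real.log Z - Real.log (p i))) =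
        ∑ a, p i * k a * D a i - p i * Real.log Z - p i * Real.log (p i) := by
      intro i
      have e : ∀ a, D a i * (p i * (k a - Real.log Z - Real.log (p i))) =
        p i * k a * D a i - D a i * (p i * Real.log Z + p i * Real.log (p i)) := by
        intro a; ring
      simp only [e, Finset.sum_sub_distrib, ← Finset.sum_mul, hDc]
      ring
    simp only [this, Finset.sum_sub_distrib]
    rw [← Finset.sum_mul, hsum, one_mul]
  rw [htrace, hS]
  linarith

theorem exp_chord (lam C x : ℝ) (hC : 0 < C) (hx : |x| ≤ C) :
    Real.exp (lam * x) ≤ Real.cosh (lam * C) + Real.sinh (lam * C) / C * x := by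
  obtain ⟨h1, h2⟩ := abs_le.mp hx
  have h3 : 0 ≤ (C + x) / (2 * C) := by apply div_nonneg <;> linarith
  have h4 : 0 ≤ (C - x) / (2 * C) := by apply div_nonneg <;> linarith
  have h5 : (C + x) / (2 * C) + (C - x) / (2 * C) = 1 := by field_simp; ring
  have := convexOn_exp.2 (Set.mem_univ (lam * C)) (Set.mem_univ (-(lam * C))) h3 h4 h5
  simp only [smul_eq_mul] at this
  have e : (C + x) / (2 * C) * (lam * C) + (C - x) / (2 * C) * -(lam * C) = lam * x := by
    field_simp; ring
  rw [e] at this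
  refine this.trans (le_of_eq ?_)
  rw [Real.cosh_eq, Real.sinh_eq]
  field_simp; ring

theorem ActsOn.mono' {n : ℕ} {S T : Finset (Fin n)} {M : QOp n} (h : ActsOn S M) (hST : S ⊆ T) :
    ActsOn T M := by
  refine ⟨fun σ τ ⟨i, hi, hne⟩ => h.1 σ τ ⟨i, fun hS => hi (hST hS), hne⟩, ?_⟩
  intro σ τ σ' τ' h1 h2 h3 h4
  by_cases hc : ∃ i ∉ S, σ i ≠ τ i
  · obtain ⟨i, hi, hne⟩ := hc
    have hiT : i ∈ T := by by_contra hT; exact hne (h3 i hT)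
    rw [h.1 σ τ ⟨i, hi, hne⟩, h.1 σ' τ' ⟨i, hi, by rwa [← h1 i hiT, ← h2 i hiT]⟩]
  · push Not at hc
    refine h.2 σ τ σ' τ' (fun i hi => h1 i (hST hi)) (fun i hi => h2 i (hST hi)) hc ?_
    intro i hi
    by_cases hT : i ∈ T
    · rw [← h1 i hT, ← h2 i hT, hc i hi]
    · exact h4 i hT

theorem ActsOn.add' {n : ℕ} {S : Finset (Fin n)} {M N : QOp n} (h : ActsOn S M) (h' : ActsOn S N) :
    ActsOn S (M + N) := by
  refine ⟨fun σ τ hne => ?_, fun σ τ σ' τ' h1 h2 h3 h4 => ?_⟩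
  · rw [Matrix.add_apply, h.1 σ τ hne, h'.1 σ τ hne, add_zero]
  · rw [Matrix.add_apply, Matrix.add_apply, h.2 σ τ σ' τ' h1 h2 h3 h4, h'.2 σ τ σ' τ' h1 h2 h3 h4]

theorem ActsOn.smul' {n : ℕ} {S : Finset (Fin n)} {M : QOp n} (c : ℂ) (h : ActsOn S M) :
    ActsOn S (c • M) := by
  refine ⟨fun σ τ hne => ?_, fun σ τ σ' τ' h1 h2 h3 h4 => ?_⟩
  · rw [Matrix.smul_apply, h.1 σ τ hne, smul_zero]
  · rw [Matrix.smul_apply, Matrix.smul_apply, h.2 σ τ σ' τ' h1 h2 h3 h4]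

theorem ActsOn.one' {n : ℕ} (S : Finset (Fin n)) : ActsOn S (1 : QOp n) := by
  refine ⟨fun σ τ ⟨i, _, hne⟩ => ?_, fun σ τ σ' τ' h1 h2 h3 h4 => ?_⟩
  · exact Matrix.one_apply_ne fun h => hne (by rw [h])
  · rw [Matrix.one_apply, Matrix.one_apply]
    have : σ = τ ↔ σ' = τ' := by
      constructor
      · intro h; ext1 i
        by_cases hi : i ∈ S
        · rw [← h1 i hi, ← h2 i hi, h]
        · exact h4 i hi
      · intro h; ext1 i
        by_cases hi : i ∈ S
        · rw [h1 i hi, h2 i hi, h]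
        · exact h3 i hi
    simp [this]

theorem ActsOn.shift' {n : ℕ} {S : Finset (Fin n)} {M : QOp n} (h : ActsOn S M)
    (δ : Fin n → Fin 2) (hδ : ∀ i ∈ S, δ i = 0) (σ τ : Fin n → Fin 2) :
    M (σ + δ) (τ + δ) = M σ τ := by
  by_cases hc : ∃ i ∉ S, σ i ≠ τ i
  · obtain ⟨i, hi, hne⟩ := hc
    rw [h.1 σ τ ⟨i, hi, hne⟩, h.1 _ _ ⟨i, hi, by simpa using hne⟩]
  · push Not at hc
    apply h.2
    · intro i hi; simp [hδ i hi]
    · intro i hi; simp [hδ i hi]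
    · intro i hi; simp [hc i hi]
    · exact hc

theorem ActsOn.mul' {n : ℕ} {S : Finset (Fin n)} {M N : QOp n} (h : ActsOn S M) (h' : ActsOn S N) :
    ActsOn S (M * N) := by
  refine ⟨fun σ τ ⟨i, hi, hne⟩ => ?_, fun σ τ σ' τ' h1 h2 h3 h4 => ?_⟩
  · rw [Matrix.mul_apply]
    refine Finset.sum_eq_zero fun ρ _ => ?_
    by_cases hc : σ i = ρ i
    · rw [h'.1 ρ τ ⟨i, hi, by rwa [← hc]⟩, mul_zero]
    · rw [h.1 σ ρ ⟨i, hi, hc⟩, zero_mul]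
  · have hδ : ∀ i ∈ S, (σ' - σ) i = 0 := fun i hi => by simp [h1 i hi]
    have e1 : σ' = σ + (σ' - σ) := by abel
    have e2 : τ' = τ + (σ' - σ) := by
      ext1 i
      by_cases hi : i ∈ S
      · simp [← h1 i hi, h2 i hi]
      · simp [h3 i hi, h4 i hi]
    rw [e1, e2, Matrix.mul_apply, Matrix.mul_apply]
    rw [← Equiv.sum_comp (Equiv.addRight (σ' - σ)) (fun x => M (σ + (σ' - σ)) x * N x (τ + (σ' - σ)))]
    refine Finset.sum_congr rfl fun ρ _ => ?_
    simp only [Equiv.coe_addRight]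
    rw [h.shift' _ hδ, h'.shift' _ hδ]

theorem ActsOn.commute' {n : ℕ} {S T : Finset (Fin n)} {M N : QOp n} (h : ActsOn S M)
    (h' : ActsOn T N) (hd : Disjoint S T) : M * N = N * M := by
  have hST : ∀ i, i ∈ T → i ∉ S := fun i hT hS => Finset.disjoint_left.mp hd hS hT
  ext σ ρ
  by_cases hc : ∃ i, i ∉ S ∧ i ∉ T ∧ σ i ≠ ρ i
  · obtain ⟨i, hS, hT, hne⟩ := hc
    have a1 := ((h.mono' (Finset.subset_union_left (s₂ := T))).mul'
      (h'.mono' (Finset.subset_union_right (s₁ := S)))).1 σ ρ ⟨i, by simp [hS, hT], hne⟩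
    have a2 := ((h'.mono' (Finset.subset_union_right (s₁ := S))).mul'
      (h.mono' (Finset.subset_union_left (s₂ := T)))).1 σ ρ ⟨i, by simp [hS, hT], hne⟩
    rw [a1, a2]
  · push Not at hc
    rw [Matrix.mul_apply, Matrix.mul_apply]
    rw [Finset.sum_eq_single (fun i => if i ∈ S then ρ i else σ i),
      Finset.sum_eq_single (fun i => if i ∈ S then σ i else ρ i)]
    · rw [mul_comm]
      congr 1
      · apply h'.2
        · intro i hi; simp [hST i hi]
        · intro i hi; simp [hST i hi]
        · intro i hi
          by_cases hS : i ∈ S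
          · simp [hS]
          · simp [hS, hc i hS hi]
        · intro i hi
          by_cases hS : i ∈ S
          · simp [hS]
          · simp [hS, hc i hS hi]
      · apply h.2
        · intro i hi; simp [hi]
        · intro i hi; simp [hi]
        · intro i hi; simp [hi]
        · intro i hi; simp [hi]
    · intro τ _ hτ
      obtain ⟨i, hi⟩ := Function.ne_iff.mp hτ
      by_cases hS : i ∈ S
      · rw [h'.1 σ τ ⟨i, Finset.disjoint_left.mp hd hS, by simpa [hS, eq_comm] using hi⟩, zero_mul]
      · rw [h.1 τ ρ ⟨i, hS, by simpa [hS] using hi⟩, mul_zero]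
    · simp
    · intro τ _ hτ
      obtain ⟨i, hi⟩ := Function.ne_iff.mp hτ
      by_cases hS : i ∈ S
      · rw [h'.1 τ ρ ⟨i, Finset.disjoint_left.mp hd hS, by simpa [hS] using hi⟩, mul_zero]
      · rw [h.1 σ τ ⟨i, hS, by simpa [hS, eq_comm] using hi⟩, zero_mul]
    · simp

/-- Exchange the parts of two configurations off `S`. -/
def swapOff {n : ℕ} (S : Finset (Fin n)) (x : (Fin n → Fin 2) × (Fin n → Fin 2)) :
    (Fin n → Fin 2) × (Fin n → Fin 2) :=
  (fun i => if i ∈ S then x.1 i else x.2 i, fun i => if i ∈ S then x.2 i else x.1 i)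

theorem swapOff_inv {n : ℕ} (S : Finset (Fin n)) : Function.Involutive (swapOff S) := by
  intro x
  unfold swapOff
  ext i
  · by_cases hi : i ∈ S <;> simp [hi]
  · by_cases hi : i ∈ S <;> simp [hi]

theorem ActsOn.trace_mul' {n : ℕ} {S T : Finset (Fin n)} {M N : QOp n} (h : ActsOn S M)
    (h' : ActsOn T N) (hd : Disjoint S T) (hN : N.trace = 0) : (M * N).trace = 0 := by
  have hST : ∀ i, i ∈ T → i ∉ S := fun i hT hS => Finset.disjoint_left.mp hd hS hT
  have e1 : (M * N).trace = ∑ σ, M σ σ * N σ σ := by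
    rw [Matrix.trace]
    refine Finset.sum_congr rfl fun σ _ => ?_
    rw [Matrix.diag_apply, Matrix.mul_apply, Finset.sum_eq_single σ]
    · intro τ _ hτ
      obtain ⟨i, hi⟩ := Function.ne_iff.mp hτ
      by_cases hS : i ∈ S
      · rw [h'.1 τ σ ⟨i, Finset.disjoint_left.mp hd hS, hi⟩, mul_zero]
      · rw [h.1 σ τ ⟨i, hS, hi.symm⟩, zero_mul]
    · simp
  have e2 : ∑ x : (Fin n → Fin 2) × (Fin n → Fin 2), M x.1 x.1 * N x.2 x.2 = 0 := by
    rw [Fintype.sum_prod_type]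
    simp only [← Finset.mul_sum]
    have : ∑ σ, N σ σ = 0 := hN
    simp [this]
  rw [← Equiv.sum_comp ((swapOff_inv S).toPerm _)] at e2
  have e3 : ∀ x : (Fin n → Fin 2) × (Fin n → Fin 2),
      M ((swapOff_inv S).toPerm _ x).1 ((swapOff_inv S).toPerm _ x).1 *
        N ((swapOff_inv S).toPerm _ x).2 ((swapOff_inv S).toPerm _ x).2 = M x.1 x.1 * N x.1 x.1 := by
    intro x
    congr 1
    · apply h.2 <;> intro i hi <;> simp [swapOff, hi]
    · apply h'.2 <;> intro i hi <;> simp [swapOff, hi]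
      intro hS; exact absurd hS (hST i hi)
      intro hS; exact absurd hS (hST i hi)
  simp only [e3] at e2
  rw [Fintype.sum_prod_type] at e2
  simp only [Finset.sum_const, ← Finset.smul_sum] at e2
  rw [e1]
  simpa using e2

theorem core {m k : ℕ} (ρ : QOp m) (hρ : ρ.PosSemidef) (htr : ρ.trace = 1)
    (h : Fin k → QOp m) (hh : ∀ l, (h l).IsHermitian) (T : Fin k → Finset (Fin m))
    (hact : ∀ l, ActsOn (T l) (h l)) (hdis : ∀ l l', l ≠ l' → Disjoint (T l) (T l'))
    (htr0 : ∀ l, (h l).trace = 0) (C : ℝ) (hC : 0 < C)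
    (hev : ∀ l (e : ℝ) (x : (Fin m → Fin 2) → ℂ), x ≠ 0 → h l *ᵥ x = (e : ℂ) • x → |e| ≤ C) :
    vnEntropy ρ ≤ m * Real.log 2 - ∑ l, ((ρ * h l).trace.re) ^ 2 / (2 * C ^ 2) := by
  obtain ⟨W, e, hW, hW', he⟩ := simdiag h hh
    (fun l l' hl => (hact l).commute' (hact l') (hdis l l' hl))
  have heC : ∀ l a, |e l a| ≤ C := by
    intro l a
    apply hev l (e l a) (W *ᵥ Pi.single a 1)
    · intro h0
      have := congrArg (fun x => Wᴴ *ᵥ x) h0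
      simp only [Matrix.mulVec_mulVec, hW, Matrix.one_mulVec, Matrix.mulVec_zero] at this
      have := congrFun this a
      simp at this
    · rw [he l, Matrix.mulVec_mulVec, Matrix.mul_assoc, hW, Matrix.mul_one, ← Matrix.mulVec_mulVec,
        Matrix.diagonal_mulVec_single, ← Matrix.mulVec_smul]
      congr 1
      ext b
      by_cases hb : b = a
      · subst hb; simp
      · simp [hb]
  set t : Fin k → ℝ := fun l => (ρ * h l).trace.re with ht
  let lam : Fin k → ℝ := fun l => t l / C ^ 2
  -- trace formula
  have prodtr : ∀ (c s : Fin k → ℝ) (F : Finset (Fin k)),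
      ∃ X : QOp m, ActsOn (F.biUnion T) X ∧
        X = W * diagonal (fun a => ((∏ l ∈ F, (c l + s l * e l a) : ℝ) : ℂ)) * Wᴴ ∧
        X.trace = 2 ^ m * ((∏ l ∈ F, c l : ℝ) : ℂ) := by
    intro c s F
    induction F using Finset.induction_on with
    | empty =>
      refine ⟨1, ActsOn.one' _, ?_, ?_⟩
      · simp [hW']
      · simp [Matrix.trace_one]
    | insert l F hl ih =>
      obtain ⟨X, hX1, hX2, hX3⟩ := ih
      have hdj : Disjoint (F.biUnion T) (T l) := by
        rw [Finset.disjoint_biUnion_left]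
        intro l' hl'
        exact hdis l' l (fun hh => hl (hh ▸ hl'))
      refine ⟨X * ((c l : ℂ) • 1 + (s l : ℂ) • h l), ?_, ?_, ?_⟩
      · apply ActsOn.mul'
        · apply hX1.mono'
          apply Finset.biUnion_subset_biUnion_of_subset_left
          exact Finset.subset_insert _ _
        · apply ActsOn.add'
          · exact (ActsOn.one' _).smul' _
          · apply ActsOn.smul'
            apply (hact l).mono'
            exact Finset.subset_biUnion_of_mem T (Finset.mem_insert_self l F)
      · have e1 : (c l : ℂ) • (1 : QOp m) + (s l : ℂ) • h l
            = W * diagonal (fun a => ((c l + s l * e l a : ℝ) : ℂ)) * Wᴴ := by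
          have : diagonal (fun a => ((c l + s l * e l a : ℝ) : ℂ)) =
              (c l : ℂ) • (1 : QOp m) + (s l : ℂ) • diagonal (fun a => (e l a : ℂ)) := by
            ext a b
            by_cases hab : a = b
            · subst hab; simp
            · simp [hab]
          rw [this, Matrix.mul_add, Matrix.add_mul, he l]
          simp [hW']
        rw [e1, hX2]
        have e2 : ∀ A B : QOp m, W * A * Wᴴ * (W * B * Wᴴ) = W * (A * B) * Wᴴ := by
          intro A B
          simp only [Matrix.mul_assoc]
          rw [← Matrix.mul_assoc Wᴴ W, hW, Matrix.one_mul]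
        rw [e2, Matrix.diagonal_mul_diagonal]
        congr 3
        ext a
        rw [Finset.prod_insert hl]
        push_cast
        ring
      · rw [Matrix.mul_add, Matrix.trace_add, Matrix.mul_smul, Matrix.mul_smul, Matrix.trace_smul,
          Matrix.trace_smul, hX1.trace_mul' (hact l) hdj (htr0 l), Matrix.mul_one, hX3,
          Finset.prod_insert hl]
        push_cast
        simp
        ring
  have hZ : ∑ a, Real.exp (∑ l, lam l * e l a) ≤ 2 ^ m * Real.exp (∑ l, (lam l * C) ^ 2 / 2) := by
    obtain ⟨X, -, hX2, hX3⟩ := prodtr (fun l => Real.cosh (lam l * C))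
      (fun l => Real.sinh (lam l * C) / C) Finset.univ
    have hX4 : X.trace = ((∑ a, ∏ l, (Real.cosh (lam l * C) + Real.sinh (lam l * C) / C * e l a) : ℝ) : ℂ) := by
      rw [hX2, Matrix.mul_assoc, Matrix.trace_mul_comm, Matrix.mul_assoc, hW, Matrix.mul_one,
        Matrix.trace_diagonal]
      push_cast
      rfl
    have hX5 : ∑ a, ∏ l, (Real.cosh (lam l * C) + Real.sinh (lam l * C) / C * e l a)
        = 2 ^ m * ∏ l, Real.cosh (lam l * C) := by
      rw [hX3] at hX4
      exact_mod_cast hX4.symm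
    calc ∑ a, Real.exp (∑ l, lam l * e l a)
        ≤ ∑ a, ∏ l, (Real.cosh (lam l * C) + Real.sinh (lam l * C) / C * e l a) := by
          refine Finset.sum_le_sum fun a _ => ?_
          rw [Real.exp_sum]
          exact Finset.prod_le_prod (fun l _ => (Real.exp_pos _).le)
            (fun l _ => exp_chord _ _ _ hC (heC l a))
      _ = 2 ^ m * ∏ l, Real.cosh (lam l * C) := hX5
      _ ≤ _ := by
          rw [Real.exp_sum]
          refine mul_le_mul_of_nonneg_left ?_ (by positivity)
          exact Finset.prod_le_prod (fun l _ => (Real.cosh_pos _).le)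
            (fun l _ => Real.cosh_le_exp_half_sq _)
  have hG := gibbs_matrix ρ hρ htr W hW hW' (fun a => ∑ l, lam l * e l a)
  have hK : W * diagonal (fun a => ((∑ l, lam l * e l a : ℝ) : ℂ)) * Wᴴ
      = ∑ l, (lam l : ℂ) • h l := by
    have : diagonal (fun a => ((∑ l, lam l * e l a : ℝ) : ℂ)) =
        ∑ l, (lam l : ℂ) • diagonal (fun a => (e l a : ℂ)) := by
      ext a b
      rw [Matrix.sum_apply]
      by_cases hab : a = b
      · subst hab; simp
      · simp [hab]
    rw [this, Matrix.mul_sum, Matrix.sum_mul]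
    refine Finset.sum_congr rfl fun l _ => ?_
    rw [he l]; simp
  have hlin : (ρ * ∑ l, (lam l : ℂ) • h l).trace.re = ∑ l, lam l * t l := by
    rw [Matrix.mul_sum, Matrix.trace_sum, Complex.re_sum]
    refine Finset.sum_congr rfl fun l _ => ?_
    rw [Matrix.mul_smul, Matrix.trace_smul, smul_eq_mul, Complex.re_ofReal_mul]
  rw [hK, hlin] at hG
  have hlog : Real.log (∑ a, Real.exp (∑ l, lam l * e l a)) ≤
      m * Real.log 2 + ∑ l, (lam l * C) ^ 2 / 2 := by
    refine (Real.log_le_log (Finset.sum_pos (fun a _ => Real.exp_pos _) Finset.univ_nonempty) hZ).trans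
      (le_of_eq ?_)
    rw [Real.log_mul (by positivity) (by positivity), Real.log_pow, Real.log_exp]
  have hfin : ∑ l, (lam l * C) ^ 2 / 2 - ∑ l, lam l * t l = - ∑ l, t l ^ 2 / (2 * C ^ 2) := by
    rw [← Finset.sum_sub_distrib, ← Finset.sum_neg_distrib]
    refine Finset.sum_congr rfl fun l _ => ?_
    simp only [lam]
    field_simp
    ring
  linarith

/-- Sites of the region starting at `s`. -/
def embS {n m : ℕ} (hmn : m ≤ n) (s : Fin n) (x : Fin m) : Fin n := ⟨x, by omega⟩ + s

/-- Configurations split into region and complement. -/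
def cfgE {n m : ℕ} [NeZero n] (hmn : m ≤ n) (s : Fin n) :
    ((Fin m → Fin 2) × (Fin (n - m) → Fin 2)) ≃ (Fin n → Fin 2) where
  toFun x := fun i => joinCfg n m x.1 x.2 (i - s)
  invFun σ := (fun x => σ (embS hmn s x), fun y => σ ((⟨m + (y : ℕ), by have := y.isLt; omega⟩ : Fin n) + s))
  left_inv x := by
    ext y
    · simp [embS, joinCfg]
    · simp [joinCfg]
  right_inv σ := by
    ext1 i
    simp only [joinCfg, embS]
    split_ifs with hi
    · simp
    · have e : (⟨m + ((i - s : Fin n) - m : ℕ), by omega⟩ : Fin n) = i - s := by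
        ext; simp; omega
      simp only [e]
      simp

theorem cfgE_emb {n m : ℕ} [NeZero n] (hmn : m ≤ n) (s : Fin n) (a : Fin m → Fin 2)
    (b : Fin (n - m) → Fin 2) (x : Fin m) : cfgE hmn s (a, b) (embS hmn s x) = a x := by
  simp [cfgE, embS, joinCfg]

theorem cfgE_off {n m : ℕ} [NeZero n] (hmn : m ≤ n) (s : Fin n) (a a' : Fin m → Fin 2)
    (b : Fin (n - m) → Fin 2) (i : Fin n) (hi : ∀ x, embS hmn s x ≠ i) :
    cfgE hmn s (a, b) i = cfgE hmn s (a', b) i := by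
  simp only [cfgE, joinCfg, Equiv.coe_fn_mk]
  split_ifs with h
  · exact absurd (by simp [embS]) (hi ⟨_, h⟩)
  · rfl

theorem embS_inj {n m : ℕ} [NeZero n] (hmn : m ≤ n) (s : Fin n) :
    Function.Injective (embS (m := m) hmn s) := by
  intro x y h
  simpa [embS, Fin.ext_iff] using h

theorem cfgE_ne {n m : ℕ} [NeZero n] (hmn : m ≤ n) (s : Fin n) (a a' : Fin m → Fin 2)
    (b b' : Fin (n - m) → Fin 2) (hb : b ≠ b') :
    ∃ i, (∀ x, embS hmn s x ≠ i) ∧ cfgE hmn s (a, b) i ≠ cfgE hmn s (a', b') i := by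
  obtain ⟨y, hy⟩ := Function.ne_iff.mp hb
  refine ⟨⟨m + y, by omega⟩ + s, ?_, ?_⟩
  · intro x hx
    simp [embS, Fin.ext_iff] at hx
    omega
  · simpa [cfgE, joinCfg] using hy

/-- Restriction of an operator to the region. -/
def redOp {n m : ℕ} [NeZero n] (hmn : m ≤ n) (s : Fin n) (M : QOp n) : QOp m :=
  fun a a' => M (cfgE hmn s (a, 0)) (cfgE hmn s (a', 0))

theorem redOp_acts {n m : ℕ} [NeZero n] (hmn : m ≤ n) (s : Fin n) (M : QOp n)
    (T : Finset (Fin m)) (h : ActsOn (T.image (embS hmn s)) M) : ActsOn T (redOp hmn s M) := by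
  have key : ∀ (b : Fin (n - m) → Fin 2) (σ τ : Fin m → Fin 2), (∀ i ∉ T, σ i = τ i) →
      ∀ i ∉ T.image (embS hmn s), cfgE hmn s (σ, b) i = cfgE hmn s (τ, b) i := by
    intro b σ τ hst i hi
    by_cases hx : ∃ x, embS hmn s x = i
    · obtain ⟨x, rfl⟩ := hx
      rw [cfgE_emb, cfgE_emb]
      apply hst
      intro hxT
      exact hi (Finset.mem_image_of_mem _ hxT)
    · push Not at hx
      exact cfgE_off _ _ _ _ _ _ hx
  have key2 : ∀ (b : Fin (n - m) → Fin 2) (σ τ : Fin m → Fin 2), (∀ i ∈ T, σ i = τ i) →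
      ∀ i ∈ T.image (embS hmn s), cfgE hmn s (σ, b) i = cfgE hmn s (τ, b) i := by
    intro b σ τ hst i hi
    obtain ⟨x, hx, rfl⟩ := Finset.mem_image.mp hi
    rw [cfgE_emb, cfgE_emb, hst x hx]
  refine ⟨fun σ τ ⟨i, hi, hne⟩ => ?_, fun σ τ σ' τ' h1 h2 h3 h4 => ?_⟩
  · apply h.1
    refine ⟨embS hmn s i, ?_, by rwa [cfgE_emb, cfgE_emb]⟩
    intro hm
    obtain ⟨x, hx, hxe⟩ := Finset.mem_image.mp hm
    rw [embS_inj hmn s hxe] at hx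
    exact hi hx
  · exact h.2 _ _ _ _ (key2 _ _ _ h1) (key2 _ _ _ h2) (key _ _ _ h3) (key _ _ _ h4)

theorem redOp_spec {n m : ℕ} [NeZero n] (hmn : m ≤ n) (s : Fin n) (M : QOp n)
    (T : Finset (Fin m)) (h : ActsOn (T.image (embS hmn s)) M) (a a' : Fin m → Fin 2)
    (b b' : Fin (n - m) → Fin 2) :
    M (cfgE hmn s (a, b)) (cfgE hmn s (a', b')) = if b = b' then redOp hmn s M a a' else 0 := by
  have hU : ActsOn (Finset.univ.image (embS hmn s)) M :=
    h.mono' (Finset.image_subset_image (Finset.subset_univ T))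
  split_ifs with hb
  · subst hb
    apply hU.2
    · intro i hi
      obtain ⟨x, _, rfl⟩ := Finset.mem_image.mp hi
      rw [cfgE_emb, cfgE_emb]
    · intro i hi
      obtain ⟨x, _, rfl⟩ := Finset.mem_image.mp hi
      rw [cfgE_emb, cfgE_emb]
    · intro i hi
      exact cfgE_off _ _ _ _ _ _ (fun x hx => hi (by simp [← hx]))
    · intro i hi
      exact cfgE_off _ _ _ _ _ _ (fun x hx => hi (by simp [← hx]))
  · obtain ⟨i, hi, hne⟩ := cfgE_ne hmn s a a' b b' hb
    exact hU.1 _ _ ⟨i, by simpa using hi, hne⟩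

theorem opNorm_eig {ι : Type} [Fintype ι] [DecidableEq ι] (M : Matrix ι ι ℂ) (C e : ℝ)
    (hM : opNorm M ≤ C) (x : ι → ℂ) (hx : x ≠ 0) (hxe : M *ᵥ x = (e : ℂ) • x) : |e| ≤ C := by
  unfold opNorm at hM
  have h1 := (LinearMap.toContinuousLinearMap (Matrix.toEuclideanLin M)).le_opNorm (WithLp.toLp 2 x)
  have h2 : (LinearMap.toContinuousLinearMap (Matrix.toEuclideanLin M)) (WithLp.toLp 2 x)
      = (e : ℂ) • WithLp.toLp 2 x := by
    rw [LinearMap.coe_toContinuousLinearMap', Matrix.toLpLin_apply, ← WithLp.toLp_smul, ← hxe]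
  rw [h2, norm_smul] at h1
  have h3 : 0 < ‖WithLp.toLp 2 x‖ := by
    rw [norm_pos_iff]
    simpa using hx
  have h4 := le_of_mul_le_mul_right h1 h3
  simp at h4
  linarith

theorem region_bound (n m : ℕ) [NeZero n] (hmeven : Even m) (hmn : 2 * m ≤ n)
    (H : Fin n → QOp n) (hloc : ∀ i, ActsOn {i, finSucc i} (H i))
    (hherm : ∀ i, (H i).IsHermitian) (htr : ∀ i, (H i).trace = 0)
    (C : ℝ) (hC : 0 < C) (hnorm : ∀ i, opNorm (H i) ≤ C) (s : Fin n) (ψ : QState n)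
    (hψ : ∑ σ, (starRingEnd ℂ) (ψ σ) * ψ σ = 1) :
    entEntropy n m (shiftState n s ψ) ≤ m * Real.log 2 -
      ∑ l : Fin (m / 2), ((star ψ ⬝ᵥ (H (⟨2 * l, by omega⟩ + s) *ᵥ ψ)).re) ^ 2 / (2 * C ^ 2) := by
  have hmn' : m ≤ n := by omega
  let k : Fin (m / 2) → Fin n := fun l => ⟨2 * l, by omega⟩ + s
  let T : Fin (m / 2) → Finset (Fin m) := fun l => {⟨2 * l, by omega⟩, ⟨2 * l + 1, by omega⟩}
  have hT : ∀ l, ActsOn ((T l).image (embS hmn' s)) (H (k l)) := by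
    intro l
    have := hloc (k l)
    have e : (T l).image (embS hmn' s) = {k l, finSucc (k l)} := by
      simp only [T, Finset.image_insert, Finset.image_singleton]
      congr 1
      congr 1
      simp only [embS, finSucc, k, Fin.ext_iff, Fin.val_add, Nat.mod_add_mod]
      congr 1
      omega
    rw [e]; exact this
  have hspec := fun l => redOp_spec hmn' s (H (k l)) (T l) (hT l)
  have hrdm : ∀ a a', rdm n m (shiftState n s ψ) a a' =
    ∑ b, ψ (cfgE hmn' s (a, b)) * (starRingEnd ℂ) (ψ (cfgE hmn' s (a', b))) := fun a a' => rfl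
  let B : Matrix (Fin m → Fin 2) (Fin (n - m) → Fin 2) ℂ := fun a b => ψ (cfgE hmn' s (a, b))
  have hB : rdm n m (shiftState n s ψ) = B * Bᴴ := by
    ext a a'
    rw [hrdm, Matrix.mul_apply]
    rfl
  have hsumE : ∀ f : (Fin n → Fin 2) → ℂ, ∑ σ, f σ = ∑ a, ∑ b, f (cfgE hmn' s (a, b)) := by
    intro f
    rw [← Equiv.sum_comp (cfgE hmn' s), Fintype.sum_prod_type]
  have h1 : (rdm n m (shiftState n s ψ)).trace = 1 := by
    rw [← hψ, hsumE, Matrix.trace]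
    refine Finset.sum_congr rfl fun a _ => ?_
    rw [Matrix.diag_apply, hrdm]
    refine Finset.sum_congr rfl fun b _ => mul_comm _ _
  have hexp : ∀ l, (rdm n m (shiftState n s ψ) * redOp hmn' s (H (k l))).trace =
      star ψ ⬝ᵥ (H (k l) *ᵥ ψ) := by
    intro l
    have r : star ψ ⬝ᵥ (H (k l) *ᵥ ψ) = ∑ a', ∑ b, ∑ a, (starRingEnd ℂ) (ψ (cfgE hmn' s (a', b))) *
        (redOp hmn' s (H (k l)) a' a * ψ (cfgE hmn' s (a, b))) := by
      simp only [dotProduct, Matrix.mulVec]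
      rw [hsumE]
      refine Finset.sum_congr rfl fun a' _ => Finset.sum_congr rfl fun b _ => ?_
      rw [hsumE, Finset.mul_sum]
      refine Finset.sum_congr rfl fun a _ => ?_
      simp only [hspec]
      simp
    rw [r, Matrix.trace_mul_comm, Matrix.trace]
    refine Finset.sum_congr rfl fun a' _ => ?_
    rw [Matrix.diag_apply, Matrix.mul_apply, Finset.sum_comm]
    refine Finset.sum_congr rfl fun a _ => ?_
    rw [hrdm, Finset.mul_sum]
    refine Finset.sum_congr rfl fun b _ => ?_
    ring
  have := core (rdm n m (shiftState n s ψ)) (by rw [hB]; exact Matrix.posSemidef_self_mul_conjTranspose B)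
    h1 (fun l => redOp hmn' s (H (k l))) ?_ T (fun l => redOp_acts _ _ _ _ (hT l)) ?_ ?_ C hC ?_
  · simp only [hexp] at this
    exact this
  · intro l
    ext a a'
    exact congrFun (congrFun (hherm (k l)) _) _
  · intro l l' hl
    have hl2 : (l : ℕ) ≠ l' := fun h => hl (Fin.ext h)
    rw [Finset.disjoint_left]
    intro x hx hx'
    simp only [T, Finset.mem_insert, Finset.mem_singleton, Fin.ext_iff] at hx hx'
    omega
  · intro l
    have := htr (k l)
    rw [Matrix.trace, hsumE] at this
    simp only [Matrix.diag_apply, hspec] at this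
    simp only [if_true, Finset.sum_const, ← Finset.smul_sum] at this
    simpa [Matrix.trace] using this
  · intro l e x hx hxe
    apply opNorm_eig (H (k l)) C e (hnorm _)
      (fun σ => if ((cfgE hmn' s).symm σ).2 = 0 then x ((cfgE hmn' s).symm σ).1 else 0)
    · intro h0
      apply hx
      ext1 a
      have := congrFun h0 (cfgE hmn' s (a, 0))
      simpa using this
    · ext σ
      obtain ⟨⟨a, b⟩, rfl⟩ := (cfgE hmn' s).surjective σ
      have hxa := congrFun hxe a
      simp only [Matrix.mulVec, dotProduct, Pi.smul_apply, smul_eq_mul] at hxa ⊢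
      rw [hsumE]
      simp only [hspec, Equiv.symm_apply_apply]
      simp only [ite_mul, zero_mul, Finset.sum_ite_eq, Finset.mem_univ, if_true, mul_ite, mul_zero]
      by_cases hb : b = 0
      · simp [hb, hxa]
      · simp [hb]

theorem energy_sum (n : ℕ) (H : Fin n → QOp n)
    (horth : ∀ i i', i ≠ i' → (H i * H i').trace = 0)
    (v : (Fin n → Fin 2) → QState n) (E : (Fin n → Fin 2) → ℝ)
    (hON : ∀ j j', ∑ σ, (starRingEnd ℂ) (v j σ) * v j' σ = if j = j' then 1 else 0)
    (heig : ∀ j, (∑ i, H i).mulVec (v j) = (E j : ℂ) • v j) :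
    ∑ j, E j ^ 2 = ∑ i, ((H i * H i).trace).re := by
  let V : QOp n := fun σ j => v j σ
  have hV : Vᴴ * V = 1 := by
    ext j j'
    rw [Matrix.mul_apply, Matrix.one_apply, ← hON j j']
    rfl
  have hV' : V * Vᴴ = 1 := mul_eq_one_comm.mp hV
  have hHV : (∑ i, H i) * V = V * diagonal (fun j => (E j : ℂ)) := by
    ext σ j
    have := congrFun (heig j) σ
    rw [Matrix.mul_diagonal, Matrix.mul_apply, mul_comm]
    simpa only [Matrix.mulVec, dotProduct, Pi.smul_apply, smul_eq_mul] using this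
  have h1 : ((∑ i, H i) * (∑ i, H i)).trace = ((∑ j, E j ^ 2 : ℝ) : ℂ) := by
    have : (∑ i, H i) * (∑ i, H i) = V * (diagonal (fun j => (E j : ℂ)) *
        diagonal (fun j => (E j : ℂ))) * Vᴴ := by
      rw [← Matrix.mul_assoc, ← hHV, Matrix.mul_assoc (∑ i, H i) V, ← hHV]
      simp only [Matrix.mul_assoc]
      rw [hV', Matrix.mul_one]
    rw [this, Matrix.trace_mul_comm, ← Matrix.mul_assoc, hV, Matrix.one_mul,
      Matrix.diagonal_mul_diagonal, Matrix.trace_diagonal]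
    push_cast
    refine Finset.sum_congr rfl fun j _ => by ring
  have h2 : ((∑ i, H i) * (∑ i, H i)).trace = ∑ i, (H i * H i).trace := by
    rw [Finset.sum_mul, Matrix.trace_sum]
    refine Finset.sum_congr rfl fun i _ => ?_
    rw [Finset.mul_sum, Matrix.trace_sum, Finset.sum_eq_single i]
    · intro i' _ hne
      exact horth i i' hne.symm
    · simp
  rw [h2] at h1
  have := congrArg Complex.re h1
  rw [Complex.re_sum, Complex.ofReal_re] at this
  exact this.symm

theorem main_bound (n m : ℕ) [NeZero n] (hmeven : Even m) (hmn : 2 * m ≤ n)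
    (H : Fin n → QOp n) (hloc : ∀ i, ActsOn {i, finSucc i} (H i))
    (hherm : ∀ i, (H i).IsHermitian) (htr : ∀ i, (H i).trace = 0)
    (horth : ∀ i i', i ≠ i' → (H i * H i').trace = 0)
    (C : ℝ) (hC : 0 < C) (hnorm : ∀ i, opNorm (H i) ≤ C)
    (v : (Fin n → Fin 2) → QState n) (E : (Fin n → Fin 2) → ℝ)
    (hON : ∀ j j', ∑ σ, (starRingEnd ℂ) (v j σ) * v j' σ = if j = j' then 1 else 0)
    (heig : ∀ j, (∑ i, H i).mulVec (v j) = (E j : ℂ) • v j) :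
    ((n : ℝ) * 2 ^ n)⁻¹ * ∑ s : Fin n, ∑ j, entEntropy n m (shiftState n s (v j))
      ≤ m * Real.log 2 -
        ((m : ℝ) / n) / (4 * n * C ^ 2) * ∑ i, ((H i * H i).trace).re / 2 ^ n := by
  have hn0 : (0 : ℝ) < n := by exact_mod_cast Nat.pos_of_ne_zero (NeZero.ne n)
  let g : (Fin n → Fin 2) → Fin n → ℝ := fun j k => (star (v j) ⬝ᵥ (H k *ᵥ v j)).re
  have hnrm : ∀ j, ∑ σ, (starRingEnd ℂ) (v j σ) * v j σ = 1 := fun j => by simp [hON]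
  have hgE : ∀ j, ∑ k, g j k = E j := by
    intro j
    have : ∑ k, star (v j) ⬝ᵥ (H k *ᵥ v j) = (E j : ℂ) := by
      rw [← dotProduct_sum, ← Matrix.sum_mulVec, heig j, dotProduct_smul]
      have h2 : star (v j) ⬝ᵥ v j = 1 := hnrm j
      rw [h2]; simp
    have := congrArg Complex.re this
    rw [Complex.re_sum, Complex.ofReal_re] at this
    exact this
  have hCS : ∀ j, E j ^ 2 ≤ n * ∑ k, g j k ^ 2 := by
    intro j
    have := sq_sum_le_card_mul_sum_sq (s := Finset.univ) (f := g j)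
    rw [hgE j] at this
    simpa using this
  have hm2 : ((m / 2 : ℕ) : ℝ) = m / 2 := by
    obtain ⟨r, hr⟩ := hmeven
    have : m / 2 = r := by omega
    rw [this, hr]; push_cast; ring
  have hj : ∀ j, ∑ s : Fin n, entEntropy n m (shiftState n s (v j)) ≤
      n * (m * Real.log 2) - m / (4 * C ^ 2 * n) * E j ^ 2 := by
    intro j
    have h1 : ∑ s : Fin n, entEntropy n m (shiftState n s (v j)) ≤
        ∑ s : Fin n, (m * Real.log 2 - ∑ l : Fin (m / 2), (g j (⟨2 * l, by omega⟩ + s)) ^ 2 / (2 * C ^ 2)) :=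
      Finset.sum_le_sum fun s _ => region_bound n m hmeven hmn H hloc hherm htr C hC hnorm s (v j) (hnrm j)
    have h2 : ∑ s : Fin n, ∑ l : Fin (m / 2), (g j (⟨2 * l, by omega⟩ + s)) ^ 2 / (2 * C ^ 2)
        = (m / 2) * ((∑ k, g j k ^ 2) / (2 * C ^ 2)) := by
      rw [Finset.sum_comm]
      have : ∀ l : Fin (m / 2), ∑ s : Fin n, (g j (⟨2 * l, by omega⟩ + s)) ^ 2 / (2 * C ^ 2)
          = (∑ k, g j k ^ 2) / (2 * C ^ 2) := by
        intro l
        rw [Finset.sum_div]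
        exact Equiv.sum_comp (Equiv.addLeft (⟨2 * l, by omega⟩ : Fin n))
          (fun k => g j k ^ 2 / (2 * C ^ 2))
      simp only [this]
      rw [Finset.sum_const, Finset.card_univ, Fintype.card_fin, nsmul_eq_mul, hm2]
    rw [Finset.sum_sub_distrib, h2, Finset.sum_const, Finset.card_univ, Fintype.card_fin,
      nsmul_eq_mul] at h1
    have h3 : m / (4 * C ^ 2 * n) * E j ^ 2 ≤ (m / 2) * ((∑ k, g j k ^ 2) / (2 * C ^ 2)) := by
      have := mul_le_mul_of_nonneg_left (hCS j) (show 0 ≤ (m : ℝ) / (4 * C ^ 2 * n) by positivity)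
      refine this.trans (le_of_eq ?_)
      field_simp
      ring
    linarith
  have hE := energy_sum n H horth v E hON heig
  have htot : ∑ s : Fin n, ∑ j, entEntropy n m (shiftState n s (v j)) ≤
      2 ^ n * (n * (m * Real.log 2)) - m / (4 * C ^ 2 * n) * ∑ i, ((H i * H i).trace).re := by
    rw [Finset.sum_comm]
    refine (Finset.sum_le_sum fun j _ => hj j).trans (le_of_eq ?_)
    rw [Finset.sum_sub_distrib, ← hE, Finset.mul_sum]
    simp
  have := mul_le_mul_of_nonneg_left htot (show 0 ≤ ((n : ℝ) * 2 ^ n)⁻¹ by positivity)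
  refine this.trans (le_of_eq ?_)
  rw [← Finset.sum_div]
  field_simp

/-- **Corollary (no translational invariance).** If every local term satisfies `‖Hᵢ‖ ≤ C` and is
traceless, then the average `S̄̄` over all `d = 2^n` eigenstates and all `n` consecutive regions
of (even) length `m` (with `f = m/n ≤ 1/2`) of the entanglement entropy satisfies
`S̄̄ ≤ m ln 2 - (f/(4nC²)) ∑ᵢ ⟨Hᵢ²⟩`; in particular, if `⟨Hᵢ²⟩ ≥ c > 0` for all `i` then
`S̄̄ ≤ m ln 2 - c f/(4C²)`. -/
theorem average_eigenstate_entanglement_no_TI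
    (n m : ℕ) (hn : 0 < n) (hmeven : Even m) (hmn : 2 * m ≤ n)
    (H1 H2 : Fin n → QOp n)
    (hloc1 : ∀ i, ActsOn {i} (H1 i))
    (hloc2 : ∀ i, ActsOn {i, finSucc i} (H2 i))
    (hherm1 : ∀ i, (H1 i).IsHermitian) (hherm2 : ∀ i, (H2 i).IsHermitian)
    (htr1 : ∀ i, (H1 i).trace = 0) (htr2 : ∀ i, (H2 i).trace = 0)
    (horth : ∀ i i', i ≠ i' → ((H1 i + H2 i) * (H1 i' + H2 i')).trace = 0)
    (C : ℝ) (hC : 0 < C)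
    (hnorm : ∀ i, opNorm (H1 i + H2 i) ≤ C)
    (v : (Fin n → Fin 2) → QState n) (E : (Fin n → Fin 2) → ℝ)
    (hON : ∀ j j', ∑ σ, (starRingEnd ℂ) (v j σ) * v j' σ = if j = j' then 1 else 0)
    (heig : ∀ j, (∑ i, (H1 i + H2 i)).mulVec (v j) = (E j : ℂ) • v j) :
    ((n : ℝ) * 2 ^ n)⁻¹ * ∑ s : Fin n, ∑ j, entEntropy n m (shiftState n s (v j))
      ≤ m * Real.log 2 -
        ((m : ℝ) / n) / (4 * n * C ^ 2) *
          ∑ i, (((H1 i + H2 i) * (H1 i + H2 i)).trace).re / 2 ^ n ∧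
    ∀ c : ℝ, 0 < c →
      (∀ i, c ≤ (((H1 i + H2 i) * (H1 i + H2 i)).trace).re / 2 ^ n) →
      ((n : ℝ) * 2 ^ n)⁻¹ * ∑ s : Fin n, ∑ j, entEntropy n m (shiftState n s (v j))
        ≤ m * Real.log 2 - c * ((m : ℝ) / n) / (4 * C ^ 2) := by
  have : NeZero n := ⟨hn.ne'⟩
  have hn0 : (0 : ℝ) < n := by exact_mod_cast hn
  have key := main_bound n m hmeven hmn (fun i => H1 i + H2 i)
    (fun i => ((hloc1 i).mono' (by simp)).add' (hloc2 i))
    (fun i => (hherm1 i).add (hherm2 i))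
    (fun i => by rw [Matrix.trace_add, htr1, htr2, add_zero]) horth C hC hnorm v E hON heig
  refine ⟨key, fun c hc hci => key.trans ?_⟩
  have h1 : (n : ℝ) * c ≤ ∑ i, (((H1 i + H2 i) * (H1 i + H2 i)).trace).re / 2 ^ n := by
    have := Finset.sum_le_sum fun i (_ : i ∈ (Finset.univ : Finset (Fin n))) => hci i
    simpa using this
  have h2 := mul_le_mul_of_nonneg_left h1
    (show 0 ≤ ((m : ℝ) / n) / (4 * n * C ^ 2) by positivity)
  have h3 : ((m : ℝ) / n) / (4 * n * C ^ 2) * (n * c) = c * ((m : ℝ) / n) / (4 * C ^ 2) := by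
    field_simp
  linarith
end
end
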